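/- arXiv:1001.2525 — 9 statements merged into one kernel-verified Lean document; each statement's English description precedes it below -/
import Mathlib

section
/- Let n = 6. The integers x ≥ 1, y ≥ 1, a ≥ 0, b ≥ 0 with gcd(x,y) = 1 satisfy x² + 5^a·11^b = y⁶ if and only if (a,b,x,y) = (1,1,3,2). -/
/-- The order `ℤ[c]`, `c ^ 3 = d`, elements `x + y c + z c ^ 2`. -/
@[ext] structure Cub (d : ℤ) where
  x : ℤ
  y : ℤ
  z : ℤ

namespace Cub
variable {d : ℤ}

instance : Zero (Cub d) := ⟨⟨0, 0, 0⟩⟩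
instance : One (Cub d) := ⟨⟨1, 0, 0⟩⟩
instance : Add (Cub d) := ⟨fun u v => ⟨u.x + v.x, u.y + v.y, u.z + v.z⟩⟩
instance : Neg (Cub d) := ⟨fun u => ⟨-u.x, -u.y, -u.z⟩⟩
instance : Mul (Cub d) := ⟨fun u v => ⟨u.x * v.x + d * (u.y * v.z + u.z * v.y),
  u.x * v.y + u.y * v.x + d * (u.z * v.z), u.x * v.z + u.y * v.y + u.z * v.x⟩⟩

@[simp] theorem zero_x : (0 : Cub d).x = 0 := rfl
@[simp] theorem zero_y : (0 : Cub d).y = 0 := rfl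
@[simp] theorem zero_z : (0 : Cub d).z = 0 := rfl
@[simp] theorem one_x : (1 : Cub d).x = 1 := rfl
@[simp] theorem one_y : (1 : Cub d).y = 0 := rfl
@[simp] theorem one_z : (1 : Cub d).z = 0 := rfl
@[simp] theorem add_x (u v : Cub d) : (u + v).x = u.x + v.x := rfl
@[simp] theorem add_y (u v : Cub d) : (u + v).y = u.y + v.y := rfl
@[simp] theorem add_z (u v : Cub d) : (u + v).z = u.z + v.z := rfl
@[simp] theorem neg_x (u : Cub d) : (-u).x = -u.x := rfl
@[simp] theorem neg_y (u : Cub d) : (-u).y = -u.y := rfl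
@[simp] theorem neg_z (u : Cub d) : (-u).z = -u.z := rfl
@[simp] theorem mul_x (u v : Cub d) :
    (u * v).x = u.x * v.x + d * (u.y * v.z + u.z * v.y) := rfl
@[simp] theorem mul_y (u v : Cub d) :
    (u * v).y = u.x * v.y + u.y * v.x + d * (u.z * v.z) := rfl
@[simp] theorem mul_z (u v : Cub d) :
    (u * v).z = u.x * v.z + u.y * v.y + u.z * v.x := rfl

instance : CommRing (Cub d) where
  add_assoc u v w := by ext <;> simp <;> ring
  zero_add u := by ext <;> simp
  add_zero u := by ext <;> simp
  add_comm u v := by ext <;> simp <;> ring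
  left_distrib u v w := by ext <;> simp <;> ring
  right_distrib u v w := by ext <;> simp <;> ring
  zero_mul u := by ext <;> simp
  mul_zero u := by ext <;> simp
  mul_assoc u v w := by ext <;> simp <;> ring
  one_mul u := by ext <;> simp
  mul_one u := by ext <;> simp
  neg_add_cancel u := by ext <;> simp
  mul_comm u v := by ext <;> simp <;> ring
  nsmul := nsmulRec
  zsmul := zsmulRec

/-- The norm. -/
def N (u : Cub d) : ℤ := u.x ^ 3 + d * u.y ^ 3 + d ^ 2 * u.z ^ 3 - 3 * d * (u.x * u.y * u.z)

theorem N_mul (u v : Cub d) : N (u * v) = N u * N v := by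
  simp only [N, mul_x, mul_y, mul_z]; ring

theorem N_one : N (1 : Cub d) = 1 := by simp [N]

/-- The adjugate. -/
def adj (u : Cub d) : Cub d :=
  ⟨u.x ^ 2 - d * (u.y * u.z), d * u.z ^ 2 - u.x * u.y, u.y ^ 2 - u.x * u.z⟩

theorem mul_adj (u : Cub d) : u * adj u = ⟨N u, 0, 0⟩ := by
  ext <;> simp [N, adj] <;> ring

theorem N_unit (u : (Cub d)ˣ) : N (u : Cub d) = 1 ∨ N (u : Cub d) = -1 := by
  have h : N (u : Cub d) * N ((u⁻¹ : (Cub d)ˣ) : Cub d) = 1 := by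
    rw [← N_mul, Units.mul_inv, N_one]
  exact Int.isUnit_iff.1 (IsUnit.of_mul_eq_one _ h)

theorem isUnit_of_N (u : Cub d) (h : N u = 1) : IsUnit u := by
  refine IsUnit.of_mul_eq_one (adj u) ?_
  rw [mul_adj, h]; rfl

/-- The real embedding. -/
def toReal (c : ℝ) (hc : c ^ 3 = d) : Cub d →+* ℝ where
  toFun u := u.x + u.y * c + u.z * c ^ 2
  map_one' := by simp
  map_zero' := by simp
  map_add' u v := by simp; ring
  map_mul' u v := by simp; rw [← hc]; ring

theorem toReal_apply (c : ℝ) (hc : c ^ 3 = d) (u : Cub d) :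
    toReal c hc u = u.x + u.y * c + u.z * c ^ 2 := rfl

theorem small (c : ℝ) (hc : c ^ 3 = d) (hc2 : 2 ≤ c) (u : Cub d)
    (hN : N u = 1 ∨ N u = -1) (h1 : 1 ≤ toReal c hc u) (h2 : toReal c hc u < 2) : u = 1 := by
  rw [toReal_apply] at h1 h2
  obtain ⟨x, y, z⟩ := u
  simp only [N] at hN
  simp only at h1 h2
  set X : ℝ := (x : ℝ) with hX
  set Y : ℝ := (y : ℝ) * c with hY
  set W : ℝ := (z : ℝ) * c ^ 2 with hW
  set t : ℝ := X + Y + W with ht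
  set Q : ℝ := X ^ 2 + Y ^ 2 + W ^ 2 - X * Y - Y * W - X * W with hQ
  have hNr : t * Q = ((x ^ 3 + d * y ^ 3 + d ^ 2 * z ^ 3 - 3 * d * (x * y * z) : ℤ) : ℝ) := by
    push_cast
    rw [ht, hQ, hX, hY, hW, ← hc]; ring
  have hQ0 : 0 ≤ Q := by nlinarith [sq_nonneg (X - Y), sq_nonneg (Y - W), sq_nonneg (X - W)]
  have htQ : t * Q ≤ 1 := by
    rw [hNr]
    rcases hN with h | h <;> rw [h] <;> norm_num
  have hQ1 : Q ≤ 1 := by nlinarith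
  have hY3 : |3 * Y - t| ≤ 2 := by
    apply abs_le_of_sq_le_sq _ (by norm_num)
    nlinarith [sq_nonneg (X - W)]
  have hW3 : |3 * W - t| ≤ 2 := by
    apply abs_le_of_sq_le_sq _ (by norm_num)
    nlinarith [sq_nonneg (X - Y)]
  rw [abs_le] at hY3 hW3
  have hy : y = 0 := by
    by_contra hne
    rcases lt_or_gt_of_ne hne with h | h
    · have : (y : ℝ) ≤ -1 := by exact_mod_cast (by omega : y ≤ -1)
      have : Y ≤ -2 := by rw [hY]; nlinarith
      linarith
    · have : (1 : ℝ) ≤ y := by exact_mod_cast (by omega : 1 ≤ y)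
      have : 2 ≤ Y := by rw [hY]; nlinarith
      linarith
  have hc4 : 4 ≤ c ^ 2 := by nlinarith
  have hz : z = 0 := by
    by_contra hne
    rcases lt_or_gt_of_ne hne with h | h
    · have : (z : ℝ) ≤ -1 := by exact_mod_cast (by omega : z ≤ -1)
      have : W ≤ -2 := by rw [hW]; nlinarith
      linarith
    · have : (1 : ℝ) ≤ z := by exact_mod_cast (by omega : 1 ≤ z)
      have : 2 ≤ W := by rw [hW]; nlinarith
      linarith
  subst hy hz
  have hxt : (x : ℝ) = t := by simp [ht, hX, hY, hW]
  have e1 : (1 : ℝ) ≤ x := by rw [hxt]; exact h1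
  have e2 : (x : ℝ) < 2 := by rw [hxt]; exact h2
  have e1' : 1 ≤ x := by exact_mod_cast e1
  have e2' : x < 2 := by exact_mod_cast e2
  have : x = 1 := by omega
  subst this
  rfl

theorem toReal_unit_ne (c : ℝ) (hc : c ^ 3 = d) (u : (Cub d)ˣ) :
    toReal c hc (u : Cub d) ≠ 0 :=
  ((Units.isUnit u).map (toReal c hc)).ne_zero

/-- logarithms of units -/
noncomputable def logUnits (c : ℝ) (hc : c ^ 3 = d) : AddSubgroup ℝ where
  carrier := {r | ∃ u : (Cub d)ˣ, Real.log (toReal c hc (u : Cub d)) = r}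
  zero_mem' := ⟨1, by simp⟩
  add_mem' := by
    rintro _ _ ⟨u, rfl⟩ ⟨v, rfl⟩
    refine ⟨u * v, ?_⟩
    rw [Units.val_mul, map_mul, Real.log_mul (toReal_unit_ne c hc u) (toReal_unit_ne c hc v)]
  neg_mem' := by
    rintro _ ⟨u, rfl⟩
    refine ⟨u⁻¹, ?_⟩
    have h : toReal c hc (u : Cub d) * toReal c hc ((u⁻¹ : (Cub d)ˣ) : Cub d) = 1 := by
      rw [← map_mul, Units.mul_inv, map_one]
    rw [eq_inv_of_mul_eq_one_right h, Real.log_inv]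

theorem eq_pm_one (c : ℝ) (hc : c ^ 3 = d) (hc2 : 2 ≤ c) (u : (Cub d)ˣ)
    (h1 : 1 ≤ |toReal c hc (u : Cub d)|) (h2 : |toReal c hc (u : Cub d)| < 2) :
    u = 1 ∨ u = -1 := by
  rcases le_total 0 (toReal c hc (u : Cub d)) with h | h
  · left
    rw [abs_of_nonneg h] at h1 h2
    exact Units.ext (small c hc hc2 _ (N_unit u) h1 h2)
  · right
    rw [abs_of_nonpos h] at h1 h2
    have := small c hc hc2 ((-u : (Cub d)ˣ) : Cub d) (N_unit (-u)) (by simpa using h1) (by simpa using h2)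
    have h3 : -u = 1 := Units.ext this
    rw [← h3, neg_neg]

theorem units_cyclic (c : ℝ) (hc : c ^ 3 = d) (hc2 : 2 ≤ c) :
    ∃ η : (Cub d)ˣ, ∀ u : (Cub d)ˣ, ∃ n : ℤ, u = η ^ n ∨ u = -η ^ n := by
  have hl2 : 0 < Real.log 2 := Real.log_pos (by norm_num)
  obtain ⟨b, hb⟩ := AddSubgroup.cyclic_of_isolated_zero (H := logUnits c hc) hl2 (by
    rw [Set.disjoint_left]
    rintro _ ⟨u, rfl⟩ ⟨h1, h2⟩
    rw [← Real.log_abs] at h1 h2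
    have hpos : 0 < |toReal c hc (u : Cub d)| := abs_pos.2 (toReal_unit_ne c hc u)
    have h1' := (Real.log_pos_iff hpos.le).1 h1
    have h2' := (Real.log_lt_log_iff hpos (by norm_num)).1 h2
    rcases eq_pm_one c hc hc2 u h1'.le h2' with h | h <;> subst h <;> simp at h1)
  have hbm : b ∈ logUnits c hc := by rw [hb]; exact AddSubgroup.subset_closure rfl
  obtain ⟨η, hη⟩ := hbm
  refine ⟨η, fun u => ?_⟩
  have hu : Real.log (toReal c hc (u : Cub d)) ∈ logUnits c hc := ⟨u, rfl⟩
  rw [hb, AddSubgroup.mem_closure_singleton] at hu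
  obtain ⟨n, hn⟩ := hu
  refine ⟨n, ?_⟩
  have key : Real.log (toReal c hc ((u * (η ^ n)⁻¹ : (Cub d)ˣ) : Cub d)) = 0 := by
    have h := toReal_unit_ne c hc (u * (η ^ n)⁻¹)
    have h4 : Real.log (toReal c hc ((η ^ n : (Cub d)ˣ) : Cub d)) = n • b := by
      let f : (Cub d)ˣ →* ℝˣ := Units.map (toReal c hc : Cub d →* ℝ)
      have : toReal c hc ((η ^ n : (Cub d)ˣ) : Cub d) = (toReal c hc (η : Cub d)) ^ n := by
        have h5 : f (η ^ n) = f η ^ n := map_zpow f η n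
        calc toReal c hc ((η ^ n : (Cub d)ˣ) : Cub d) = (f (η ^ n) : ℝ) := rfl
          _ = ((f η ^ n : ℝˣ) : ℝ) := by rw [h5]
          _ = _ := Units.val_zpow_eq_zpow_val _ _
      rw [this, Real.log_zpow, hη]; simp
    have h5 : Real.log (toReal c hc ((u * (η ^ n)⁻¹ : (Cub d)ˣ) : Cub d))
        + Real.log (toReal c hc ((η ^ n : (Cub d)ˣ) : Cub d)) = Real.log (toReal c hc (u : Cub d)) := by
      rw [← Real.log_mul h (toReal_unit_ne c hc _), ← map_mul, ← Units.val_mul, inv_mul_cancel_right]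
    linarith
  have hne := toReal_unit_ne c hc (u * (η ^ n)⁻¹)
  have habs : |toReal c hc ((u * (η ^ n)⁻¹ : (Cub d)ˣ) : Cub d)| = 1 := by
    rw [← Real.log_abs] at key
    exact Real.eq_one_of_pos_of_log_eq_zero (abs_pos.2 hne) key
  rcases eq_pm_one c hc hc2 _ habs.ge (by rw [habs]; norm_num) with h | h
  · left; exact mul_inv_eq_one.1 h
  · right
    rw [mul_inv_eq_iff_eq_mul] at h
    rw [h]; simp
end Cub
namespace Cub
variable {d : ℤ}

section Log
variable (p : ℕ) [Fact p.Prime]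

def L1 (u : Cub d) : ZMod p := (u.y : ZMod p) / u.x
def L2 (u : Cub d) : ZMod p := 2 * (u.z : ZMod p) / u.x - ((u.y : ZMod p) / u.x) ^ 2

theorem x_mul (hd : (d : ZMod p) = 0) (u v : Cub d) : ((u * v).x : ZMod p) = u.x * v.x := by
  simp [hd]

theorem x_pow (hd : (d : ZMod p) = 0) (u : Cub d) (n : ℕ) : ((u ^ n).x : ZMod p) = (u.x : ZMod p) ^ n := by
  induction n with
  | zero => simp
  | succ n ih => rw [pow_succ, x_mul p hd, ih, pow_succ]

theorem x_ne_of_N (hd : (d : ZMod p) = 0) (u : Cub d) (h : (N u : ZMod p) ≠ 0) : (u.x : ZMod p) ≠ 0 := by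
  intro h0
  apply h
  simp [N, hd, h0]

theorem x_unit (hd : (d : ZMod p) = 0) (u : (Cub d)ˣ) : (((u : Cub d).x : ℤ) : ZMod p) ≠ 0 := by
  apply x_ne_of_N p hd
  rcases N_unit u with h | h <;> rw [h] <;> simp

theorem L1_mul (hd : (d : ZMod p) = 0) (u v : Cub d) (hu : (u.x : ZMod p) ≠ 0) (hv : (v.x : ZMod p) ≠ 0) :
    L1 p (u * v) = L1 p u + L1 p v := by
  simp only [L1, mul_x, mul_y]
  push_cast
  rw [hd]
  field_simp
  ring

theorem L2_mul (hd : (d : ZMod p) = 0) (u v : Cub d) (hu : (u.x : ZMod p) ≠ 0) (hv : (v.x : ZMod p) ≠ 0) :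
    L2 p (u * v) = L2 p u + L2 p v := by
  simp only [L2, mul_x, mul_y, mul_z]
  push_cast
  rw [hd]
  field_simp
  ring

theorem L1_pow (hd : (d : ZMod p) = 0) (u : Cub d) (hu : (u.x : ZMod p) ≠ 0) (n : ℕ) :
    L1 p (u ^ n) = n * L1 p u := by
  induction n with
  | zero => simp [L1]
  | succ n ih =>
    rw [pow_succ, L1_mul p hd _ _ (by rw [x_pow p hd]; exact pow_ne_zero _ hu) hu, ih]
    push_cast; ring

theorem L2_pow (hd : (d : ZMod p) = 0) (u : Cub d) (hu : (u.x : ZMod p) ≠ 0) (n : ℕ) :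
    L2 p (u ^ n) = n * L2 p u := by
  induction n with
  | zero => simp [L2]
  | succ n ih =>
    rw [pow_succ, L2_mul p hd _ _ (by rw [x_pow p hd]; exact pow_ne_zero _ hu) hu, ih]
    push_cast; ring

theorem L_zpow (hd : (d : ZMod p) = 0) (η : (Cub d)ˣ) (n : ℤ) :
    L1 p ((η ^ n : (Cub d)ˣ) : Cub d) = n * L1 p (η : Cub d) ∧
    L2 p ((η ^ n : (Cub d)ˣ) : Cub d) = n * L2 p (η : Cub d) := by
  let f : (Cub d)ˣ →* Multiplicative (ZMod p × ZMod p) :=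
    { toFun := fun u => Multiplicative.ofAdd (L1 p (u : Cub d), L2 p (u : Cub d))
      map_one' := by simp [L1, L2]
      map_mul' := fun u v => by
        rw [Units.val_mul, L1_mul p hd _ _ (x_unit p hd u) (x_unit p hd v),
          L2_mul p hd _ _ (x_unit p hd u) (x_unit p hd v)]
        rfl }
  have h := map_zpow f η n
  have h' : (L1 p ((η ^ n : (Cub d)ˣ) : Cub d), L2 p ((η ^ n : (Cub d)ˣ) : Cub d)) =
      n • (L1 p (η : Cub d), L2 p (η : Cub d)) := congrArg Multiplicative.toAdd h
  rw [Prod.smul_mk, Prod.mk.injEq] at h'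
  simpa using h'

theorem L_neg (u : Cub d) : L1 p (-u) = L1 p u ∧ L2 p (-u) = L2 p u := by
  constructor <;> simp [L1, L2, neg_div_neg_eq]

theorem det_units (hd : (d : ZMod p) = 0) (c : ℝ) (hc : c ^ 3 = d) (hc2 : 2 ≤ c) (u v : (Cub d)ˣ) :
    L1 p (u : Cub d) * L2 p (v : Cub d) = L1 p (v : Cub d) * L2 p (u : Cub d) := by
  obtain ⟨η, hη⟩ := units_cyclic c hc hc2
  have key : ∀ u : (Cub d)ˣ, ∃ n : ℤ, L1 p (u : Cub d) = n * L1 p (η : Cub d) ∧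
      L2 p (u : Cub d) = n * L2 p (η : Cub d) := by
    intro u
    obtain ⟨n, h | h⟩ := hη u
    · exact ⟨n, by rw [h]; exact L_zpow p hd η n⟩
    · refine ⟨n, ?_⟩
      rw [h, Units.val_neg, (L_neg p _).1, (L_neg p _).2]
      exact L_zpow p hd η n
  obtain ⟨m, h1, h2⟩ := key u
  obtain ⟨n, h3, h4⟩ := key v
  rw [h1, h2, h3, h4]; ring

/-- The key relation. -/
theorem det_rel (hd : (d : ZMod p) = 0) (hd8 : 8 ≤ d) (w β ε : Cub d) (n : ℕ) (u : (Cub d)ˣ) (hε : N ε = 1)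
    (hβ : (β.x : ZMod p) ≠ 0) (hw : w = β ^ n * u) :
    (L1 p w - n * L1 p β) * L2 p ε = L1 p ε * (L2 p w - n * L2 p β) := by
  obtain ⟨v, rfl⟩ := isUnit_of_N ε hε
  have hd0 : (8 : ℝ) ≤ d := by exact_mod_cast hd8
  have hc : ((d : ℝ) ^ (1 / 3 : ℝ)) ^ 3 = d := by
    rw [← Real.rpow_natCast, ← Real.rpow_mul (by linarith)]; norm_num
  have hc2 : 2 ≤ (d : ℝ) ^ (1 / 3 : ℝ) := by
    have h0 : 0 ≤ (d : ℝ) ^ (1 / 3 : ℝ) := by positivity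
    by_contra hlt
    push Not at hlt
    have : ((d : ℝ) ^ (1 / 3 : ℝ)) ^ 3 < 2 ^ 3 := by gcongr
    rw [hc] at this
    linarith
  have h := det_units p hd _ hc hc2 u v
  have hx : ((β ^ n).x : ZMod p) ≠ 0 := by rw [x_pow p hd]; exact pow_ne_zero _ hβ
  rw [hw, L1_mul p hd _ _ hx (x_unit p hd u), L2_mul p hd _ _ hx (x_unit p hd u),
    L1_pow p hd _ hβ, L2_pow p hd _ hβ]
  linear_combination h
end Log
end Cub
namespace Cub
instance fact11 : Fact (Nat.Prime 11) := ⟨by norm_num⟩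
instance fact5 : Fact (Nat.Prime 5) := ⟨by norm_num⟩

theorem L_eq {d : ℤ} (p : ℕ) [Fact p.Prime] (x y z : ℤ) (l1 l2 : ZMod p) (hx : (x : ZMod p) ≠ 0)
    (h1 : (y : ZMod p) = l1 * x) (h2 : 2 * (z : ZMod p) = (l2 + l1 ^ 2) * x) :
    L1 p (⟨x, y, z⟩ : Cub d) = l1 ∧ L2 p (⟨x, y, z⟩ : Cub d) = l2 := by
  have e1 : (y : ZMod p) / x = l1 := by rw [div_eq_iff hx, h1]
  refine ⟨e1, ?_⟩
  simp only [L2]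
  rw [e1, sub_eq_iff_eq_add, div_eq_iff hx, h2]

/-! ### The field generated by a cube root of 44 -/
section D44

def beta44 : Cub 44 := ⟨5, -12, 3⟩

theorem step44 (w : Cub 44) (hN : 125 ∣ N w)
    (hP : ¬ (5 ∣ w.x - 16 * w.z ∧ 5 ∣ w.y - 4 * w.z)) :
    ∃ w1 : Cub 44, w = beta44 * w1 ∧
      ¬ (5 ∣ w1.x - 16 * w1.z ∧ 5 ∣ w1.y - 4 * w1.z) := by
  obtain ⟨x, y, z⟩ := w
  simp only [N] at hN hP
  have h1 : (125 : ℤ) ∣ (x + 114 * y + 114 ^ 2 * z) *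
      ((x ^ 2 - 44 * (y * z)) + 114 * (44 * z ^ 2 - x * y) + 114 ^ 2 * (y ^ 2 - x * z)) := by
    obtain ⟨k, hk⟩ := hN
    refine ⟨k + 11852 * (y * (y ^ 2 - x * z) + z * (44 * z ^ 2 - x * y)
      + 114 * (z * (y ^ 2 - x * z))), ?_⟩
    linear_combination hk
  have h2 : IsCoprime (125 : ℤ)
      ((x ^ 2 - 44 * (y * z)) + 114 * (44 * z ^ 2 - x * y) + 114 ^ 2 * (y ^ 2 - x * z)) := by
    have h3 : (125 : ℤ) = 5 ^ 3 := by norm_num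
    rw [h3]
    apply IsCoprime.pow_left
    have hpr : Prime (5 : ℤ) := by norm_num
    rw [hpr.coprime_iff_not_dvd]
    intro h4
    apply hP
    have h5 : ∀ a b c : ZMod 5, (a ^ 2 - 44 * (b * c)) + 114 * (44 * c ^ 2 - a * b)
        + 114 ^ 2 * (b ^ 2 - a * c) = 0 → a - 16 * c = 0 ∧ b - 4 * c = 0 := by decide +kernel
    have h6 := (ZMod.intCast_zmod_eq_zero_iff_dvd _ 5).2 h4
    push_cast at h6
    obtain ⟨h7, h8⟩ := h5 x y z h6
    constructor
    · apply (ZMod.intCast_zmod_eq_zero_iff_dvd _ 5).1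
      push_cast; exact h7
    · apply (ZMod.intCast_zmod_eq_zero_iff_dvd _ 5).1
      push_cast; exact h8
  have h3 : (125 : ℤ) ∣ x + 114 * y + 114 ^ 2 * z := h2.dvd_of_dvd_mul_right h1
  obtain ⟨k, hk⟩ := h3
  have hx : x = 125 * k - 114 * y - 114 ^ 2 * z := by linarith
  obtain ⟨t0, h0⟩ : (125 : ℤ) ∣ 1609 * x + 44 * (y * 129 + z * 456) := by omega
  obtain ⟨t1, h1⟩ : (125 : ℤ) ∣ x * 456 + y * 1609 + 44 * (z * 129) := by omega
  obtain ⟨t2, h2⟩ : (125 : ℤ) ∣ x * 129 + y * 456 + z * 1609 := by omega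
  refine ⟨⟨t0, t1, t2⟩, ?_, ?_⟩
  · ext <;> simp only [beta44, mul_x, mul_y, mul_z] <;> linarith
  · rintro ⟨h4, h5⟩
    simp only at h4 h5
    apply hP
    have ex : x = 5 * t0 + 44 * (-12 * t2 + 3 * t1) := by linarith
    have ey : y = 5 * t1 + -12 * t0 + 44 * (3 * t2) := by linarith
    have ez : z = 5 * t2 + -12 * t1 + 3 * t0 := by linarith
    constructor <;> omega

theorem div44 (n : ℕ) : ∀ w : Cub 44, N w = 125 ^ n →
    ¬ (5 ∣ w.x - 16 * w.z ∧ 5 ∣ w.y - 4 * w.z) →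
    ∃ u : (Cub 44)ˣ, w = beta44 ^ n * u := by
  induction n with
  | zero =>
    intro w hN _
    obtain ⟨u, hu⟩ := isUnit_of_N w (by simpa using hN)
    exact ⟨u, by simp [hu]⟩
  | succ n ih =>
    intro w hN hP
    obtain ⟨w1, h1, h2⟩ := step44 w (by rw [hN, pow_succ]; exact dvd_mul_left _ _) hP
    have h3 : N w1 = 125 ^ n := by
      have h4 : N w = 125 * N w1 := by
        rw [h1, N_mul]; congr 1
      rw [hN, pow_succ] at h4
      linarith
    obtain ⟨u, hu⟩ := ih w1 h3 h2
    exact ⟨u, by rw [h1, hu, pow_succ]; ring⟩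

theorem rel44 (n : ℕ) (Y s : ℤ) (hY : 11 ∣ Y) (hY5 : ¬ (5 ∣ Y))
    (hN : N (⟨Y + 16 * s, 4 * s, s⟩ : Cub 44) = 125 ^ n) : 11 ∣ 3 * n + 1 := by
  obtain ⟨u, hu⟩ := div44 n _ hN (by
    simp only
    rintro ⟨h, -⟩
    apply hY5
    rwa [add_sub_cancel_right] at h)
  have hd : ((44 : ℤ) : ZMod 11) = 0 := by decide
  have hY0 : (Y : ZMod 11) = 0 := (ZMod.intCast_zmod_eq_zero_iff_dvd _ _).2 hY
  have hx := x_ne_of_N 11 hd (⟨Y + 16 * s, 4 * s, s⟩ : Cub 44) (by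
    rw [hN]; push_cast; exact pow_ne_zero _ (by decide))
  have key := det_rel 11 hd (by norm_num) (⟨Y + 16 * s, 4 * s, s⟩ : Cub 44) beta44
    (⟨1585, 303, -213⟩ : Cub 44) n u (by simp [N]) (by decide) hu
  obtain ⟨a1, a2⟩ := L_eq (d := 44) 11 (Y + 16 * s) (4 * s) s 3 9 hx
    (by push_cast; rw [hY0]
        linear_combination (s : ZMod 11) * (by decide : (4 - 3 * 16 : ZMod 11) = 0))
    (by push_cast; rw [hY0]
        linear_combination (s : ZMod 11) *
          (by decide : (2 - (9 + 3 ^ 2) * 16 : ZMod 11) = 0))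
  obtain ⟨b1, b2⟩ := L_eq (d := 44) 11 5 (-12) 3 2 6 (by decide) (by decide) (by decide)
  obtain ⟨c1, c2⟩ := L_eq (d := 44) 11 1585 303 (-213) 6 0 (by decide) (by decide) (by decide)
  rw [a1, a2, c1, c2, beta44, b1, b2] at key
  have fin : ∀ m : ZMod 11, (3 - m * 2) * 0 = 6 * (9 - m * 6) →
      3 * m + 1 = 0 := by decide
  have := fin _ key
  exact_mod_cast (ZMod.natCast_eq_zero_iff (3 * n + 1) 11).1 (by push_cast; exact this)
end D44

/-! ### The field generated by a cube root of 20 -/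
section D20

def beta20 : Cub 20 := ⟨11, -12, 3⟩

theorem step20 (w : Cub 20) (hN : 1331 ∣ N w)
    (hP : ¬ (11 ∣ w.x - 16 * w.z ∧ 11 ∣ w.y - 4 * w.z)) :
    ∃ w1 : Cub 20, w = beta20 * w1 ∧
      ¬ (11 ∣ w1.x - 16 * w1.z ∧ 11 ∣ w1.y - 4 * w1.z) := by
  obtain ⟨x, y, z⟩ := w
  simp only [N] at hN hP
  have h1 : (1331 : ℤ) ∣ (x + 1082 * y + 1082 ^ 2 * z) *
      ((x ^ 2 - 20 * (y * z)) + 1082 * (20 * z ^ 2 - x * y) + 1082 ^ 2 * (y ^ 2 - x * z)) := by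
    obtain ⟨k, hk⟩ := hN
    refine ⟨k + 951708 * (y * (y ^ 2 - x * z) + z * (20 * z ^ 2 - x * y)
      + 1082 * (z * (y ^ 2 - x * z))), ?_⟩
    linear_combination hk
  have h2 : IsCoprime (1331 : ℤ)
      ((x ^ 2 - 20 * (y * z)) + 1082 * (20 * z ^ 2 - x * y) + 1082 ^ 2 * (y ^ 2 - x * z)) := by
    have h3 : (1331 : ℤ) = 11 ^ 3 := by norm_num
    rw [h3]
    apply IsCoprime.pow_left
    have hpr : Prime (11 : ℤ) := by norm_num
    rw [hpr.coprime_iff_not_dvd]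
    intro h4
    apply hP
    have h5 : ∀ a b c : ZMod 11, (a ^ 2 - 20 * (b * c)) + 1082 * (20 * c ^ 2 - a * b)
        + 1082 ^ 2 * (b ^ 2 - a * c) = 0 → a - 16 * c = 0 ∧ b - 4 * c = 0 := by decide +kernel
    have h6 := (ZMod.intCast_zmod_eq_zero_iff_dvd _ 11).2 h4
    push_cast at h6
    obtain ⟨h7, h8⟩ := h5 x y z h6
    constructor
    · apply (ZMod.intCast_zmod_eq_zero_iff_dvd _ 11).1
      push_cast; exact h7
    · apply (ZMod.intCast_zmod_eq_zero_iff_dvd _ 11).1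
      push_cast; exact h8
  have h3 : (1331 : ℤ) ∣ x + 1082 * y + 1082 ^ 2 * z := h2.dvd_of_dvd_mul_right h1
  obtain ⟨k, hk⟩ := h3
  have hx : x = 1331 * k - 1082 * y - 1082 ^ 2 * z := by linarith
  obtain ⟨t0, h0⟩ : (1331 : ℤ) ∣ 841 * x + 20 * (y * 111 + z * 312) := by omega
  obtain ⟨t1, h1⟩ : (1331 : ℤ) ∣ x * 312 + y * 841 + 20 * (z * 111) := by omega
  obtain ⟨t2, h2⟩ : (1331 : ℤ) ∣ x * 111 + y * 312 + z * 841 := by omega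
  refine ⟨⟨t0, t1, t2⟩, ?_, ?_⟩
  · ext <;> simp only [beta20, mul_x, mul_y, mul_z] <;> linarith
  · rintro ⟨h4, h5⟩
    simp only at h4 h5
    apply hP
    have ex : x = 11 * t0 + 20 * (-12 * t2 + 3 * t1) := by linarith
    have ey : y = 11 * t1 + -12 * t0 + 20 * (3 * t2) := by linarith
    have ez : z = 11 * t2 + -12 * t1 + 3 * t0 := by linarith
    constructor <;> omega

theorem div20 (n : ℕ) : ∀ w : Cub 20, N w = 1331 ^ n →
    ¬ (11 ∣ w.x - 16 * w.z ∧ 11 ∣ w.y - 4 * w.z) →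
    ∃ u : (Cub 20)ˣ, w = beta20 ^ n * u := by
  induction n with
  | zero =>
    intro w hN _
    obtain ⟨u, hu⟩ := isUnit_of_N w (by simpa using hN)
    exact ⟨u, by simp [hu]⟩
  | succ n ih =>
    intro w hN hP
    obtain ⟨w1, h1, h2⟩ := step20 w (by rw [hN, pow_succ]; exact dvd_mul_left _ _) hP
    have h3 : N w1 = 1331 ^ n := by
      have h4 : N w = 1331 * N w1 := by
        rw [h1, N_mul]; congr 1
      rw [hN, pow_succ] at h4
      linarith
    obtain ⟨u, hu⟩ := ih w1 h3 h2
    exact ⟨u, by rw [h1, hu, pow_succ]; ring⟩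

theorem rel20 (n : ℕ) (Y s : ℤ) (hY : 5 ∣ Y) (hY5 : ¬ (11 ∣ Y))
    (hN : N (⟨Y + 16 * s, 4 * s, s⟩ : Cub 20) = 1331 ^ n) : 5 ∣ 3 * n + 1 := by
  obtain ⟨u, hu⟩ := div20 n _ hN (by
    simp only
    rintro ⟨h, -⟩
    apply hY5
    rwa [add_sub_cancel_right] at h)
  have hd : ((20 : ℤ) : ZMod 5) = 0 := by decide
  have hY0 : (Y : ZMod 5) = 0 := (ZMod.intCast_zmod_eq_zero_iff_dvd _ _).2 hY
  have hx := x_ne_of_N 5 hd (⟨Y + 16 * s, 4 * s, s⟩ : Cub 20) (by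
    rw [hN]; push_cast; exact pow_ne_zero _ (by decide))
  have key := det_rel 5 hd (by norm_num) (⟨Y + 16 * s, 4 * s, s⟩ : Cub 20) beta20
    (⟨-19, 7, 0⟩ : Cub 20) n u (by simp [N]) (by decide) hu
  obtain ⟨a1, a2⟩ := L_eq (d := 20) 5 (Y + 16 * s) (4 * s) s 4 1 hx
    (by push_cast; rw [hY0]
        linear_combination (s : ZMod 5) * (by decide : (4 - 4 * 16 : ZMod 5) = 0))
    (by push_cast; rw [hY0]
        linear_combination (s : ZMod 5) *
          (by decide : (2 - (1 + 4 ^ 2) * 16 : ZMod 5) = 0))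
  obtain ⟨b1, b2⟩ := L_eq (d := 20) 5 11 (-12) 3 3 2 (by decide) (by decide) (by decide)
  obtain ⟨c1, c2⟩ := L_eq (d := 20) 5 (-19) 7 0 2 1 (by decide) (by decide) (by decide)
  rw [a1, a2, c1, c2, beta20, b1, b2] at key
  have fin : ∀ m : ZMod 5, (4 - m * 3) * 1 = 2 * (1 - m * 2) →
      3 * m + 1 = 0 := by decide
  have := fin _ key
  exact_mod_cast (ZMod.natCast_eq_zero_iff (3 * n + 1) 5).1 (by push_cast; exact this)
end D20
end Cub
theorem pow_mod_period (g q M a : ℕ) (hg : g ^ M % q = 1 % q) : g ^ (a % M) % q = g ^ a % q := by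
  have h : g ^ M ≡ 1 [MOD q] := hg
  have h2 : g ^ a ≡ g ^ (a % M) [MOD q] := by
    conv_lhs => rw [← Nat.div_add_mod a M, pow_add, pow_mul]
    simpa using (h.pow (a / M)).mul_right (g ^ (a % M))
  exact h2.symm

theorem two_cube_mod (q y : ℕ) (T : ℕ → Bool) (hq : 0 < q)
    (hT : ∀ y < q, T (2 * y ^ 3 % q) = true) : T (2 * y ^ 3 % q) = true := by
  have h := hT (y % q) (Nat.mod_lt _ hq)
  rwa [Nat.mul_mod, Nat.pow_mod, Nat.mod_mod, ← Nat.pow_mod, ← Nat.mul_mod] at h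

theorem sieve1 (q M : ℕ) (T : ℕ → Bool) (hq : 0 < q) (h5 : 5 ^ M % q = 1 % q)
    (h11 : 11 ^ M % q = 1 % q) (hT : ∀ y < q, T (2 * y ^ 3 % q) = true) {a b y : ℕ}
    (h : 5 ^ a + 11 ^ b = 2 * y ^ 3) :
    T ((5 ^ (a % M) % q + 11 ^ (b % M) % q) % q) = true := by
  rw [pow_mod_period _ _ _ _ h5, pow_mod_period _ _ _ _ h11, ← Nat.add_mod, h]
  exact two_cube_mod q y T hq hT

theorem sieve2 (q M : ℕ) (T : ℕ → Bool) (hq : 0 < q) (h5 : 5 ^ M % q = 1 % q)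
    (h11 : 11 ^ M % q = 1 % q) (hT : ∀ y < q, T (2 * y ^ 3 % q) = true) {a b y : ℕ}
    (h : 1 + 5 ^ a * 11 ^ b = 2 * y ^ 3) :
    T ((1 % q + (5 ^ (a % M) % q) * (11 ^ (b % M) % q) % q) % q) = true := by
  rw [pow_mod_period _ _ _ _ h5, pow_mod_period _ _ _ _ h11, ← Nat.mul_mod, ← Nat.add_mod, h]
  exact two_cube_mod q y T hq hT

/-- Cubic residue test. -/
def TE (q v : ℕ) : Bool := Nat.ble ((v * ((q + 1) / 2) % q) ^ ((q - 1) / 3) % q) 1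
/-- Test modulo small numbers. -/
def TS (l : List ℕ) (v : ℕ) : Bool := l.any (Nat.beq v)

def test1 (i j : ℕ) : Bool :=
  TS [0, 2, 6, 10, 14] ((5 ^ i % 16 + 11 ^ j % 16) % 16) &&
  (TS [0, 2, 7] ((5 ^ i % 9 + 11 ^ j % 9) % 9) &&
  (TE 7 ((5 ^ i % 7 + 11 ^ j % 7) % 7) &&
  (TE 13 ((5 ^ i % 13 + 11 ^ j % 13) % 13) &&
  (TE 19 ((5 ^ i % 19 + 11 ^ j % 19) % 19) &&
  TE 37 ((5 ^ i % 37 + 11 ^ j % 37) % 37)))))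

def test2 (i j : ℕ) : Bool :=
  TS [0, 2, 6, 10, 14] ((1 % 16 + (5 ^ i % 16) * (11 ^ j % 16) % 16) % 16) &&
  (TS [0, 2, 7] ((1 % 9 + (5 ^ i % 9) * (11 ^ j % 9) % 9) % 9) &&
  (TE 13 ((1 % 13 + (5 ^ i % 13) * (11 ^ j % 13) % 13) % 13) &&
  (TE 19 ((1 % 19 + (5 ^ i % 19) * (11 ^ j % 19) % 19) % 19) &&
  TE 37 ((1 % 37 + (5 ^ i % 37) * (11 ^ j % 37) % 37) % 37))))

def test3 (i j : ℕ) : Bool :=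
  TE 31 ((5 ^ i % 31 + 11 ^ j % 31) % 31) &&
  (TE 61 ((5 ^ i % 61 + 11 ^ j % 61) % 61) &&
  (TE 67 ((5 ^ i % 67 + 11 ^ j % 67) % 67) &&
  (TE 181 ((5 ^ i % 181 + 11 ^ j % 181) % 181) &&
  (TE 199 ((5 ^ i % 199 + 11 ^ j % 199) % 199) &&
  (TE 331 ((5 ^ i % 331 + 11 ^ j % 331) % 331) &&
  TE 397 ((5 ^ i % 397 + 11 ^ j % 397) % 397))))))

theorem test1_of {a b y : ℕ} (h : 5 ^ a + 11 ^ b = 2 * y ^ 3) : test1 (a % 36) (b % 36) = true := by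
  simp only [test1, Bool.and_eq_true]
  refine ⟨?_, ?_, ?_, ?_, ?_, ?_⟩
  · exact sieve1 16 36 _ (by decide) (by decide +kernel) (by decide +kernel) (by decide +kernel) h
  · exact sieve1 9 36 _ (by decide) (by decide +kernel) (by decide +kernel) (by decide +kernel) h
  · exact sieve1 7 36 (TE 7) (by decide) (by decide +kernel) (by decide +kernel) (by decide +kernel) h
  · exact sieve1 13 36 (TE 13) (by decide) (by decide +kernel) (by decide +kernel) (by decide +kernel) h
  · exact sieve1 19 36 (TE 19) (by decide) (by decide +kernel) (by decide +kernel) (by decide +kernel) h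
  · exact sieve1 37 36 (TE 37) (by decide) (by decide +kernel) (by decide +kernel) (by decide +kernel) h

theorem test2_of {a b y : ℕ} (h : 1 + 5 ^ a * 11 ^ b = 2 * y ^ 3) :
    test2 (a % 36) (b % 36) = true := by
  simp only [test2, Bool.and_eq_true]
  refine ⟨?_, ?_, ?_, ?_, ?_⟩
  · exact sieve2 16 36 _ (by decide) (by decide +kernel) (by decide +kernel) (by decide +kernel) h
  · exact sieve2 9 36 _ (by decide) (by decide +kernel) (by decide +kernel) (by decide +kernel) h
  · exact sieve2 13 36 (TE 13) (by decide) (by decide +kernel) (by decide +kernel) (by decide +kernel) h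
  · exact sieve2 19 36 (TE 19) (by decide) (by decide +kernel) (by decide +kernel) (by decide +kernel) h
  · exact sieve2 37 36 (TE 37) (by decide) (by decide +kernel) (by decide +kernel) (by decide +kernel) h

theorem test3_of {a b y : ℕ} (h : 5 ^ a + 11 ^ b = 2 * y ^ 3) :
    test3 (a % 1980) (b % 1980) = true := by
  simp only [test3, Bool.and_eq_true]
  refine ⟨?_, ?_, ?_, ?_, ?_, ?_, ?_⟩
  · exact sieve1 31 1980 (TE 31) (by decide) (by decide +kernel) (by decide +kernel) (by decide +kernel) h
  · exact sieve1 61 1980 (TE 61) (by decide) (by decide +kernel) (by decide +kernel) (by decide +kernel) h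
  · exact sieve1 67 1980 (TE 67) (by decide) (by decide +kernel) (by decide +kernel) (by decide +kernel) h
  · exact sieve1 181 1980 (TE 181) (by decide) (by decide +kernel) (by decide +kernel) (by decide +kernel) h
  · exact sieve1 199 1980 (TE 199) (by decide) (by decide +kernel) (by decide +kernel) (by decide +kernel) h
  · exact sieve1 331 1980 (TE 331) (by decide) (by decide +kernel) (by decide +kernel) (by decide +kernel) h
  · exact sieve1 397 1980 (TE 397) (by decide) (by decide +kernel) (by decide +kernel) (by decide +kernel) h

set_option synthInstance.maxHeartbeats 200000 in
set_option synthInstance.maxSize 1000 in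
theorem table1 : ∀ i < 36, ∀ j < 36, test1 i j = true →
    (i % 6 = 0 ∧ j % 6 = 0) ∨ (i = 1 ∧ j % 12 = 1) ∨ (i = 11 ∧ j % 12 = 4) := by
  decide +kernel

theorem table2 : ∀ i < 36, ∀ j < 36, test2 i j = true → i % 6 = 0 ∧ j % 6 = 0 := by
  decide +kernel

theorem table3 : ∀ i < 55, ∀ j < 165, test3 (36 * i + 11) (12 * j + 4) = false := by
  decide +kernel

theorem table4 : ∀ i < 5, ∀ j < 33, test3 (396 * i + 253) (60 * j + 25) = false := by
  decide +kernel

theorem cube_descent (X Y y : ℕ) (hX : X % 6 = 1) (hY : Y % 6 = 1)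
    (hc : Nat.Coprime X Y) (h : X ^ 3 + Y ^ 3 = 2 * y ^ 3) : ∃ u, X + Y = 2 * u ^ 3 := by
  obtain ⟨w, hw⟩ : ∃ w, X + Y = 2 * w := ⟨(X + Y) / 2, by omega⟩
  have hwZ : (X : ℤ) + Y = 2 * w := by exact_mod_cast hw
  have hZ : (X : ℤ) ^ 3 + Y ^ 3 = 2 * y ^ 3 := by exact_mod_cast h
  have hmul : (w : ℤ) * ((X : ℤ) ^ 2 - X * Y + Y ^ 2) = (y : ℤ) ^ 3 := by
    have : (2 : ℤ) * (w * ((X : ℤ) ^ 2 - X * Y + Y ^ 2)) = 2 * y ^ 3 := by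
      rw [← hZ, ← mul_assoc, ← hwZ]; ring
    linarith
  have hcZ : IsCoprime (X : ℤ) Y := Nat.isCoprime_iff_coprime.2 hc
  have hwX : IsCoprime (w : ℤ) X := by
    have : IsCoprime (2 * (w : ℤ)) X := by
      rw [← hwZ]
      have h3 := hcZ.symm.add_mul_left_left 1
      rwa [mul_one, add_comm] at h3
    exact this.of_mul_left_right
  have hwY : IsCoprime (w : ℤ) Y := by
    have : IsCoprime (2 * (w : ℤ)) Y := by
      rw [← hwZ]
      have h3 := hcZ.add_mul_left_left 1
      rwa [mul_one] at h3
    exact this.of_mul_left_right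
  have hw3 : IsCoprime (w : ℤ) 3 := by
    have : Nat.Coprime w 3 := by
      rw [Nat.coprime_comm, Nat.Prime.coprime_iff_not_dvd (by norm_num)]; omega
    exact_mod_cast Nat.isCoprime_iff_coprime.2 this
  have hco : IsCoprime (w : ℤ) ((X : ℤ) ^ 2 - X * Y + Y ^ 2) := by
    have e : (X : ℤ) ^ 2 - X * Y + Y ^ 2 = (-(3 * (X * Y))) + w * (4 * w) := by
      have : ((X : ℤ) + Y) ^ 2 = (2 * w) ^ 2 := by rw [hwZ]
      linear_combination this
    rw [e]
    exact ((hw3.mul_right (hwX.mul_right hwY)).neg_right).add_mul_left_right _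
  obtain ⟨u, hu⟩ := Int.eq_pow_of_mul_eq_pow_odd_left hco (by decide) hmul
  have hu0 : 0 ≤ u := by
    by_contra hneg
    have : u ^ 3 < 0 := Odd.pow_neg (by decide) (by omega)
    omega
  lift u to ℕ using hu0
  exact ⟨u, by rw [hw]; congr 1; exact_mod_cast hu⟩

theorem even_pow_mod (g k : ℕ) (hg : g % 6 = 5) (hk : k % 2 = 0) : g ^ k % 6 = 1 := by
  obtain ⟨m, rfl⟩ : ∃ m, k = 2 * m := ⟨k / 2, by omega⟩
  rw [pow_mul, Nat.pow_mod, Nat.pow_mod g 2, hg]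
  simp

theorem coprime_pows (k l : ℕ) : Nat.Coprime (5 ^ k) (11 ^ l) :=
  Nat.Coprime.pow _ _ (by norm_num)

theorem desc1 (n : ℕ) : ∀ k l y : ℕ, k + l = n → k % 2 = 0 → l % 2 = 0 →
    5 ^ k + 11 ^ l = 2 * y ^ 3 → k = 0 ∧ l = 0 := by
  induction n using Nat.strong_induction_on with
  | _ n ih =>
    intro k l y hn hk hl h
    have ht := table1 _ (Nat.mod_lt k (by norm_num)) _ (Nat.mod_lt l (by norm_num)) (test1_of h)
    obtain ⟨k', rfl⟩ : ∃ k', k = k' * 3 := ⟨k / 3, by omega⟩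
    obtain ⟨l', rfl⟩ : ∃ l', l = l' * 3 := ⟨l / 3, by omega⟩
    rw [pow_mul, pow_mul] at h
    obtain ⟨u, hu⟩ := cube_descent _ _ _ (even_pow_mod 5 k' (by norm_num) (by omega))
      (even_pow_mod 11 l' (by norm_num) (by omega)) (coprime_pows _ _) h
    by_cases h0 : k' + l' = 0
    · omega
    · have := ih (k' + l') (by omega) k' l' u rfl (by omega) (by omega) hu
      omega

theorem desc2 (n : ℕ) : ∀ k l y : ℕ, k + l = n →
    1 + 5 ^ k * 11 ^ l = 2 * y ^ 3 → k = 0 ∧ l = 0 := by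
  induction n using Nat.strong_induction_on with
  | _ n ih =>
    intro k l y hn h
    have ht := table2 _ (Nat.mod_lt k (by norm_num)) _ (Nat.mod_lt l (by norm_num)) (test2_of h)
    obtain ⟨k', rfl⟩ : ∃ k', k = k' * 3 := ⟨k / 3, by omega⟩
    obtain ⟨l', rfl⟩ : ∃ l', l = l' * 3 := ⟨l / 3, by omega⟩
    rw [pow_mul, pow_mul, ← mul_pow] at h
    have e1 := even_pow_mod 5 k' (by norm_num) (by omega)
    have e2 := even_pow_mod 11 l' (by norm_num) (by omega)
    obtain ⟨u, hu⟩ := cube_descent 1 (5 ^ k' * 11 ^ l') y (by norm_num)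
      (by rw [Nat.mul_mod, e1, e2]) (by simp) (by rw [one_pow]; exact h)
    by_cases h0 : k' + l' = 0
    · omega
    · have := ih (k' + l') (by omega) k' l' u rfl hu
      omega
theorem y_even {k l y : ℕ} (h : 5 ^ (36 * k + 1) + 11 ^ (12 * l + 1) = 2 * y ^ 3) : y % 2 = 0 := by
  by_contra hy
  have h5 : 5 ^ (36 * k + 1) % 4 = 1 := by rw [Nat.pow_mod]; simp
  have h11 : 11 ^ (12 * l + 1) % 4 = 3 := by
    rw [pow_succ, pow_mul, Nat.mul_mod, Nat.pow_mod]; simp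
  have : y ^ 3 % 2 = 1 := by rw [Nat.pow_mod, show y % 2 = 1 by omega]
  omega

theorem KA (k l y : ℕ) (hl : 1 ≤ l) (h : 5 ^ (36 * k + 1) + 11 ^ (12 * l + 1) = 2 * y ^ 3) :
    11 ∣ 36 * k + 1 := by
  have hy2 := y_even h
  set Y : ℕ := 11 ^ (4 * l) with hY
  have hYodd : Y % 2 = 1 := by rw [hY, Nat.pow_mod]; simp
  have h' : 5 * 5 ^ (36 * k) + 11 * Y ^ 3 = 2 * y ^ 3 := by
    rw [← h, hY, ← pow_mul, pow_succ, pow_succ, show 4 * l * 3 = 12 * l by ring]; ring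
  have h5 : (y : ZMod 5) = 2 * Y := by
    have e := congrArg (fun t : ℕ => (t : ZMod 5)) h'
    push_cast at e
    have : ∀ a b c : ZMod 5, 5 * c + 11 * b ^ 3 = 2 * a ^ 3 → a = 2 * b := by decide +kernel
    exact this _ _ _ e
  have h5' : (5 : ℤ) ∣ (y : ℤ) - 2 * Y := by
    apply (ZMod.intCast_zmod_eq_zero_iff_dvd _ 5).1
    push_cast; rw [h5]; ring
  obtain ⟨s, hs⟩ : (10 : ℤ) ∣ (y : ℤ) - 2 * Y := by omega
  have hyZ : (y : ℤ) = 2 * Y + 10 * s := by linarith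
  have hZ : 5 * 5 ^ (36 * k) + 11 * (Y : ℤ) ^ 3 = 2 * (y : ℤ) ^ 3 := by exact_mod_cast h'
  have := Cub.rel44 (12 * k) (Y : ℤ) s
    (by rw [hY]; push_cast; exact dvd_pow_self _ (by omega))
    (by
      intro hd
      have h1 : 5 ∣ Y := by exact_mod_cast hd
      have h2 := Nat.Prime.dvd_of_dvd_pow (by norm_num) h1
      omega)
    (by
      have e : (125 : ℤ) ^ (12 * k) = 5 ^ (36 * k) := by
        rw [show (125 : ℤ) = 5 ^ 3 by norm_num, ← pow_mul]; congr 1; ring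
      rw [e]
      simp only [Cub.N]
      rw [hyZ] at hZ
      linarith [hZ])
  have e : 3 * (12 * k) + 1 = 36 * k + 1 := by ring
  rwa [e] at this

theorem KB (k l y : ℕ) (hk : 1 ≤ k) (h : 5 ^ (36 * k + 1) + 11 ^ (12 * l + 1) = 2 * y ^ 3) :
    5 ∣ 12 * l + 1 := by
  have hy2 := y_even h
  set X : ℕ := 5 ^ (12 * k) with hX
  have h' : 5 * X ^ 3 + 11 * 11 ^ (12 * l) = 2 * y ^ 3 := by
    rw [← h, hX, ← pow_mul, pow_succ, pow_succ, show 12 * k * 3 = 36 * k by ring]; ring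
  have h5 : (y : ZMod 11) = 2 * X := by
    have e := congrArg (fun t : ℕ => (t : ZMod 11)) h'
    push_cast at e
    have : ∀ a b c : ZMod 11, 5 * b ^ 3 + 11 * c = 2 * a ^ 3 → a = 2 * b := by decide +kernel
    exact this _ _ _ e
  have h5' : (11 : ℤ) ∣ (y : ℤ) - 2 * X := by
    apply (ZMod.intCast_zmod_eq_zero_iff_dvd _ 11).1
    push_cast; rw [h5]; ring
  obtain ⟨s, hs⟩ : (22 : ℤ) ∣ (y : ℤ) - 2 * X := by omega
  have hyZ : (y : ℤ) = 2 * X + 22 * s := by linarith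
  have hZ : 5 * (X : ℤ) ^ 3 + 11 * 11 ^ (12 * l) = 2 * (y : ℤ) ^ 3 := by exact_mod_cast h'
  have := Cub.rel20 (4 * l) (X : ℤ) s
    (by rw [hX]; push_cast; exact dvd_pow_self _ (by omega))
    (by
      intro hd
      have h1 : 11 ∣ X := by exact_mod_cast hd
      have h2 := Nat.Prime.dvd_of_dvd_pow (by norm_num) h1
      omega)
    (by
      have e : (1331 : ℤ) ^ (4 * l) = 11 ^ (12 * l) := by
        rw [show (1331 : ℤ) = 11 ^ 3 by norm_num, ← pow_mul]; congr 1; ring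
      rw [e]
      simp only [Cub.N]
      rw [hyZ] at hZ
      linarith [hZ])
  have e : 3 * (4 * l) + 1 = 12 * l + 1 := by ring
  rwa [e] at this

theorem main1 {a b y : ℕ} (h : 5 ^ a + 11 ^ b = 2 * y ^ 3) :
    (a = 0 ∧ b = 0) ∨ (a = 1 ∧ b = 1) := by
  have ht := table1 _ (Nat.mod_lt a (by norm_num)) _ (Nat.mod_lt b (by norm_num)) (test1_of h)
  have h3 := test3_of h
  rcases ht with ⟨h1, h2⟩ | ⟨h1, h2⟩ | ⟨h1, h2⟩
  · left
    exact desc1 _ a b y rfl (by omega) (by omega) h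
  · right
    obtain ⟨k, rfl⟩ : ∃ k, a = 36 * k + 1 := ⟨a / 36, by omega⟩
    obtain ⟨l, rfl⟩ : ∃ l, b = 12 * l + 1 := ⟨b / 12, by omega⟩
    have hA := KA k l y
    have hB := KB k l y
    by_cases hk : 1 ≤ k
    · have h5 := hB hk h
      by_cases hl : 1 ≤ l
      · exfalso
        have h11 := hA hl h
        have h4 := table4 ((36 * k + 1) % 1980 / 396) (by omega) ((12 * l + 1) % 1980 / 60) (by omega)
        have e1 : 396 * ((36 * k + 1) % 1980 / 396) + 253 = (36 * k + 1) % 1980 := by omega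
        have e2 : 60 * ((12 * l + 1) % 1980 / 60) + 25 = (12 * l + 1) % 1980 := by omega
        rw [e1, e2, h3] at h4
        exact Bool.noConfusion h4
      · omega
    · by_cases hl : 1 ≤ l
      · have h11 := hA hl h
        omega
      · omega
  · exfalso
    have h4 := table3 (a % 1980 / 36) (by omega) (b % 1980 / 12) (by omega)
    have e1 : 36 * (a % 1980 / 36) + 11 = a % 1980 := by omega
    have e2 : 12 * (b % 1980 / 12) + 4 = b % 1980 := by omega
    rw [e1, e2, h3] at h4
    exact Bool.noConfusion h4

theorem dvd_form {P a b : ℕ} (h : P ∣ 5 ^ a * 11 ^ b) : ∃ i j, P = 5 ^ i * 11 ^ j := by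
  obtain ⟨p1, p2, h1, h2, rfl⟩ := (Nat.dvd_mul).1 h
  obtain ⟨i, _, rfl⟩ := (Nat.dvd_prime_pow (by norm_num)).1 h1
  obtain ⟨j, _, rfl⟩ := (Nat.dvd_prime_pow (by norm_num)).1 h2
  exact ⟨i, j, rfl⟩

theorem fin55 {a b : ℕ} (h : 5 ^ a * 11 ^ b = 55) : a = 1 ∧ b = 1 := by
  have ha : a < 3 := by
    by_contra hlt
    have : 5 ^ 3 ≤ 5 ^ a := Nat.pow_le_pow_right (by norm_num) (by omega)
    have : 1 ≤ 11 ^ b := Nat.one_le_pow _ _ (by norm_num)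
    nlinarith
  have hb : b < 2 := by
    by_contra hlt
    have : 11 ^ 2 ≤ 11 ^ b := Nat.pow_le_pow_right (by norm_num) (by omega)
    have : 1 ≤ 5 ^ a := Nat.one_le_pow _ _ (by norm_num)
    nlinarith
  interval_cases a <;> interval_cases b <;> simp_all

theorem eq_x_sq_add_5a_11b_eq_y_sixth (x y a b : ℕ) (hx : 1 ≤ x) (hy : 1 ≤ y)
    (hcop : Nat.gcd x y = 1) :
    x ^ 2 + 5 ^ a * 11 ^ b = y ^ 6 ↔ (a, b, x, y) = (1, 1, 3, 2) := by
  constructor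
  swap
  · intro h
    simp only [Prod.mk.injEq] at h
    obtain ⟨rfl, rfl, rfl, rfl⟩ := h
    norm_num
  intro h
  have hlt : x < y ^ 3 := by
    have : 0 < 5 ^ a * 11 ^ b := by positivity
    have e6 : (y ^ 3) ^ 2 = y ^ 6 := by ring
    have h2 : x ^ 2 < (y ^ 3) ^ 2 := by
      rw [e6]; omega
    exact lt_of_pow_lt_pow_left₀ 2 (Nat.zero_le _) h2
  obtain ⟨P, hP⟩ : ∃ P, y ^ 3 = x + P := ⟨y ^ 3 - x, by omega⟩
  have hPQ : P * (P + 2 * x) = 5 ^ a * 11 ^ b := by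
    have : x ^ 2 + 5 ^ a * 11 ^ b = (x + P) ^ 2 := by rw [h, ← hP, ← pow_mul]
    nlinarith
  have hodd : Nat.Coprime (P * (P + 2 * x)) 2 := by
    rw [hPQ]
    exact Nat.Coprime.mul_left (Nat.Coprime.pow_left _ (by norm_num)) (Nat.Coprime.pow_left _ (by norm_num))
  have hPx : Nat.Coprime P x := by
    have h1 : Nat.Coprime (y ^ 3) x := Nat.Coprime.pow_left 3 (Nat.coprime_comm.1 hcop)
    rw [hP] at h1
    simpa using h1
  have hco : Nat.Coprime P (P + 2 * x) := by
    have h2 : Nat.Coprime P (2 * x) := Nat.Coprime.mul_right (Nat.Coprime.coprime_mul_right hodd) hPx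
    simpa using h2
  have hsum : P + (P + 2 * x) = 2 * y ^ 3 := by rw [hP]; ring
  obtain ⟨i, j, hPf⟩ := dvd_form (Dvd.intro _ hPQ)
  obtain ⟨i', j', hQf⟩ := dvd_form (Dvd.intro_left _ hPQ)
  have hi : i = 0 ∨ i' = 0 := by
    by_contra hcon
    push Not at hcon
    have h1 : 5 ∣ P := by rw [hPf]; exact Dvd.dvd.mul_right (dvd_pow_self _ hcon.1) _
    have h2 : 5 ∣ P + 2 * x := by rw [hQf]; exact Dvd.dvd.mul_right (dvd_pow_self _ hcon.2) _
    have := Nat.dvd_gcd h1 h2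
    rw [hco] at this
    omega
  have hj : j = 0 ∨ j' = 0 := by
    by_contra hcon
    push Not at hcon
    have h1 : 11 ∣ P := by rw [hPf]; exact Dvd.dvd.mul_left (dvd_pow_self _ hcon.1) _
    have h2 : 11 ∣ P + 2 * x := by rw [hQf]; exact Dvd.dvd.mul_left (dvd_pow_self _ hcon.2) _
    have := Nat.dvd_gcd h1 h2
    rw [hco] at this
    omega
  have fin : P = 5 → P + 2 * x = 11 → (a, b, x, y) = (1, 1, 3, 2) := by
    intro h1 h2
    have hx3 : x = 3 := by omega
    have hy8 : y ^ 3 = 2 ^ 3 := by rw [hP, hx3, h1]; norm_num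
    have hy2 : y = 2 := Nat.pow_left_injective (by norm_num) hy8
    have h55 : 5 ^ a * 11 ^ b = 55 := by rw [← hPQ, h1, hx3]
    obtain ⟨ha, hb⟩ := fin55 h55
    rw [ha, hb, hx3, hy2]
  rw [hQf, hPf] at hsum
  rcases hi with rfl | rfl <;> rcases hj with rfl | rfl
  · have := desc2 _ i' j' y rfl (by simpa using hsum)
    rw [this.1, this.2] at hQf
    simp at hPf hQf; omega
  · rcases main1 (a := i') (b := j) (y := y) (by rw [← hsum]; ring) with ⟨h1, h2⟩ | ⟨h1, h2⟩ <;>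
    · rw [h1] at hQf
      rw [h2] at hPf
      norm_num at hPf hQf; omega
  · rcases main1 (a := i) (b := j') (y := y) (by rw [← hsum]; ring) with ⟨h1, h2⟩ | ⟨h1, h2⟩
    · rw [h2] at hQf
      rw [h1] at hPf
      norm_num at hPf hQf; omega
    · rw [h2] at hQf
      rw [h1] at hPf
      norm_num at hPf hQf
      exact fin hPf hQf
  · have := desc2 _ i j y rfl (by rw [← hsum]; ring)
    rw [this.1, this.2] at hPf
    have : 1 ≤ 5 ^ 0 * 11 ^ 0 := by norm_num
    simp at hPf hQf; omega
end

section
/- Let n = 4. There are no integers x ≥ 1, y ≥ 1, a ≥ 0, b ≥ 0 with gcd(x,y) = 1 satisfying x² + 5^a·11^b = y⁴. -/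
/-- An odd prime cannot divide both factors `y² - x` and `y² + x`. -/
lemma not_dvd_both (x y u p : ℕ) (hp : p.Prime) (h2 : p ≠ 2) (hcop : Nat.gcd x y = 1)
    (hu : y ^ 2 = x + u) : ¬ p ∣ u ∨ ¬ p ∣ u + 2 * x := by
  by_contra h
  push Not at h
  obtain ⟨h1, h3⟩ := h
  have h4 : p ∣ 2 * x := (Nat.dvd_add_right h1).1 h3
  have h5 : p ∣ x := by
    rcases hp.dvd_mul.1 h4 with h | h
    · exact absurd ((Nat.prime_dvd_prime_iff_eq hp Nat.prime_two).1 h) h2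
    · exact h
  have h6 : p ∣ y := hp.dvd_of_dvd_pow (hu ▸ dvd_add h5 h1 : p ∣ y ^ 2)
  have h7 := Nat.dvd_gcd h5 h6
  rw [hcop] at h7
  exact hp.one_lt.ne' (Nat.dvd_one.1 h7)

/-- One of the factors has no `p` in it, so it divides the rest `m`; the other is divisible
by `p` if `p` occurs. -/
lemma factor_split (x y u p a m : ℕ) (hp : p.Prime) (h2 : p ≠ 2) (ha : a ≠ 0)
    (hcop : Nat.gcd x y = 1)
    (hu : y ^ 2 = x + u) (h : u * (u + 2 * x) = p ^ a * m) :
    ∃ w z, w ∣ m ∧ p ∣ z ∧ w + z = 2 * y ^ 2 := by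
  have hd : p ∣ u * (u + 2 * x) := h ▸ (dvd_pow_self p ha).mul_right m
  rcases not_dvd_both x y u p hp h2 hcop hu with h1 | h1
  · refine ⟨u, u + 2 * x, ?_, (hp.dvd_mul.1 hd).resolve_left h1, by omega⟩
    have hc : Nat.Coprime u (p ^ a) :=
      (Nat.Coprime.pow_left a ((Nat.Prime.coprime_iff_not_dvd hp).2 h1)).symm
    exact hc.dvd_of_dvd_mul_left (h ▸ dvd_mul_right _ _)
  · refine ⟨u + 2 * x, u, ?_, (hp.dvd_mul.1 hd).resolve_right h1, by omega⟩
    have hc : Nat.Coprime (u + 2 * x) (p ^ a) :=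
      (Nat.Coprime.pow_left a ((Nat.Prime.coprime_iff_not_dvd hp).2 h1)).symm
    exact hc.dvd_of_dvd_mul_left (h ▸ dvd_mul_left _ _)

theorem eq_x_sq_add_5a_11b_ne_y_fourth (x y a b : ℕ) (hx : 1 ≤ x) (hy : 1 ≤ y)
    (hcop : Nat.gcd x y = 1) :
    x ^ 2 + 5 ^ a * 11 ^ b ≠ y ^ 4 := by
  intro h
  have hpos : 0 < 5 ^ a * 11 ^ b := by positivity
  have hlt : x < y ^ 2 := by
    by_contra hc
    push Not at hc
    have := Nat.pow_le_pow_left hc 2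
    have h4 : (y ^ 2) ^ 2 = y ^ 4 := by ring
    omega
  obtain ⟨u, hu⟩ := Nat.exists_eq_add_of_le hlt.le
  have huv : u * (u + 2 * x) = 5 ^ a * 11 ^ b := by
    have h4 : y ^ 4 = (x + u) ^ 2 := by rw [← hu]; ring
    rw [h4] at h
    nlinarith
  by_cases ha : a = 0
  · by_cases hb : b = 0
    · subst ha hb
      have := Nat.eq_one_of_mul_eq_one_left (by simpa using huv)
      have := Nat.eq_one_of_mul_eq_one_right (by simpa using huv)
      omega
    · subst ha
      obtain ⟨w, z, hw, hz, hs⟩ := factor_split x y u 11 b 1 (by norm_num) (by norm_num) hb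
        hcop hu (by simpa using huv)
      have hw1 : w = 1 := Nat.dvd_one.1 hw
      have hm : (2 * y ^ 2) % 11 = 1 := by omega
      have : y % 11 < 11 := Nat.mod_lt _ (by norm_num)
      rw [Nat.mul_mod, Nat.pow_mod] at hm
      interval_cases y % 11 <;> omega
  · obtain ⟨w, z, hw, hz, hs⟩ := factor_split x y u 5 a (11 ^ b) (by norm_num) (by norm_num) ha
      hcop hu huv
    obtain ⟨k, -, rfl⟩ := (Nat.dvd_prime_pow (by norm_num)).1 hw
    have hk : 11 ^ k % 5 = 1 := by simp [Nat.pow_mod]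
    have hm : (2 * y ^ 2) % 5 = 1 := by omega
    have : y % 5 < 5 := Nat.mod_lt _ (by norm_num)
    rw [Nat.mul_mod, Nat.pow_mod] at hm
    interval_cases y % 5 <;> omega
end

section
/- There are no integers x, y, a, b with x ≠ 0, a ≥ 0, b ≥ 0, a ≡ 5 (mod 6), b ≡ 4 (mod 6), gcd(x, 55) = 1, satisfying x² + 5^a·11^b = y³. -/
theorem qform_eq_one (p q : ℤ) (h : p ^ 2 + 5 * q ^ 2 = 1) : q = 0 ∧ (p = 1 ∨ p = -1) := by
  have hq : q ^ 2 = 0 := by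
    have := sq_nonneg p
    have := sq_nonneg q
    omega
  exact ⟨by simpa using hq, sq_eq_sq_iff_eq_or_eq_neg.1 (by linarith)⟩

theorem qform_ne_eight (p q : ℤ) (h : p ^ 2 + 5 * q ^ 2 = 2 ^ 3) : False := by
  have hp := sq_nonneg p
  have hq := sq_nonneg q
  have a1 : q ≤ 1 := by nlinarith
  have a2 : -1 ≤ q := by nlinarith
  have a3 : p ≤ 2 := by nlinarith
  have a4 : -2 ≤ p := by nlinarith
  interval_cases q <;> interval_cases p <;> omega

/-- Reduction of positive definite binary forms of discriminant `-20`. -/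
theorem form_small (n : ℕ) : ∀ A B C : ℤ, 0 < A → A.toNat ≤ n → A * C - B ^ 2 = 5 →
    ∃ X Y : ℤ, A * X ^ 2 + 2 * B * X * Y + C * Y ^ 2 = 1 ∨
      A * X ^ 2 + 2 * B * X * Y + C * Y ^ 2 = 2 := by
  induction n with
  | zero => intro A B C h1 h2; omega
  | succ n ih =>
    intro A B C hA hn h
    obtain ⟨m, B', hB, hl, hu⟩ : ∃ m B' : ℤ, B = B' + m * A ∧ -A ≤ 2 * B' ∧ 2 * B' ≤ A := by
      have h1 := Int.emod_add_mul_ediv B A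
      have h2 := Int.emod_nonneg B hA.ne'
      have h3 := Int.emod_lt_of_pos B hA
      by_cases h4 : 2 * (B % A) ≤ A
      · exact ⟨B / A, B % A, by linarith, by linarith, h4⟩
      · exact ⟨B / A + 1, B % A - A, by linarith, by linarith, by linarith⟩
    have hC' : A * (C - 2 * m * B' - m ^ 2 * A) - B' ^ 2 = 5 := by
      rw [← h, hB]; ring
    obtain ⟨C', hC⟩ : ∃ C', C' = C - 2 * m * B' - m ^ 2 * A := ⟨_, rfl⟩
    rw [← hC] at hC'
    have hCpos : 0 < C' := by
      by_contra hc
      nlinarith [sq_nonneg B', mul_nonneg hA.le (sub_nonneg.2 (not_lt.1 hc))]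
    have hCC : C = C' + 2 * m * B' + m ^ 2 * A := by linarith
    by_cases hlt : C' < A
    · obtain ⟨X, Y, hXY⟩ := ih C' B' A hCpos (by omega) (by linarith)
      refine ⟨Y - m * X, X, ?_⟩
      have e : A * (Y - m * X) ^ 2 + 2 * B * (Y - m * X) * X + C * X ^ 2
        = C' * X ^ 2 + 2 * B' * X * Y + A * Y ^ 2 := by
        rw [hCC, hB]; ring
      rw [e]; exact hXY
    · have hA2 : A ≤ 2 := by
        have : 4 * B' ^ 2 ≤ A ^ 2 := by nlinarith
        have : A * A ≤ A * C' := mul_le_mul_of_nonneg_left (not_lt.1 hlt) hA.le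
        by_contra hc
        nlinarith
      refine ⟨1, 0, ?_⟩
      have : A = 1 ∨ A = 2 := by omega
      simpa using this

/-- The descent in `ℤ[√-5]`. -/
theorem cube_descent_s4 (x w y : ℤ) (hy : 0 < y) (hc : IsCoprime w (y ^ 3))
    (h : x ^ 2 + 5 * w ^ 2 = y ^ 3) :
    ∃ s t : ℤ, (x = s * (s ^ 2 - 15 * t ^ 2) ∨ x = -(s * (s ^ 2 - 15 * t ^ 2))) ∧
      (w = t * (3 * s ^ 2 - 5 * t ^ 2) ∨ w = -(t * (3 * s ^ 2 - 5 * t ^ 2))) := by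
  obtain ⟨i, j, hij⟩ := hc
  -- r = i * x
  obtain ⟨r, hr⟩ : ∃ r, r = i * x := ⟨_, rfl⟩
  have hrw : x = r * w + y ^ 3 * (j * x) := by rw [hr]; linear_combination (-x) * hij
  obtain ⟨e, he⟩ : ∃ e, r ^ 2 + 5 = y ^ 3 * e := by
    refine ⟨i ^ 2 + 5 * (j * (1 + i * w)), ?_⟩
    rw [hr]
    linear_combination i ^ 2 * h - 5 * (1 + i * w) * hij
  obtain ⟨X, Y, hXY⟩ := form_small _ y r (y ^ 2 * e) hy le_rfl (by linear_combination -he)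
  obtain ⟨k, hk⟩ : ∃ k, k = y * X ^ 2 + 2 * r * X * Y + y ^ 2 * e * Y ^ 2 := ⟨_, rfl⟩
  rw [← hk] at hXY
  obtain ⟨s, hs⟩ : ∃ s, s = X * y + Y * r := ⟨_, rfl⟩
  have hst : s ^ 2 + 5 * Y ^ 2 = k * y := by
    rw [hk, hs]; linear_combination Y ^ 2 * he
  obtain ⟨P, hP⟩ : ∃ P, P = s * (s ^ 2 - 15 * Y ^ 2) := ⟨_, rfl⟩
  obtain ⟨Q, hQ⟩ : ∃ Q, Q = Y * (3 * s ^ 2 - 5 * Y ^ 2) := ⟨_, rfl⟩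
  have hPQ : P ^ 2 + 5 * Q ^ 2 = (k * y) ^ 3 := by
    rw [← hst, hP, hQ]; ring
  obtain ⟨p, hp⟩ : ∃ p, P * x + 5 * Q * w = y ^ 3 * p := by
    have : y ^ 3 ∣ P * r + 5 * Q := by
      refine ⟨X ^ 3 * r + e * (3 * X ^ 2 * Y * y ^ 2 + 3 * X * Y ^ 2 * y * r
        + Y ^ 3 * (r ^ 2 - 5)), ?_⟩
      rw [hP, hQ, hs]
      linear_combination (3 * X ^ 2 * Y * y ^ 2 + 3 * X * Y ^ 2 * y * r
        + Y ^ 3 * (r ^ 2 - 5)) * he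
    obtain ⟨c, hc⟩ := this
    exact ⟨w * c + P * (j * x), by linear_combination P * hrw + w * hc⟩
  obtain ⟨q, hq⟩ : ∃ q, Q * x - P * w = y ^ 3 * q := by
    have : y ^ 3 ∣ Q * r - P := by
      refine ⟨- X ^ 3 + e * (3 * X * Y ^ 2 * y + 2 * Y ^ 3 * r), ?_⟩
      rw [hP, hQ, hs]
      linear_combination (3 * X * Y ^ 2 * y + 2 * Y ^ 3 * r) * he
    obtain ⟨c, hc⟩ := this
    exact ⟨w * c + Q * (j * x), by linear_combination Q * hrw + w * hc⟩
  have hy3 : y ^ 3 ≠ 0 := by positivity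
  have hN : p ^ 2 + 5 * q ^ 2 = k ^ 3 := by
    have : (y ^ 3) ^ 2 * (p ^ 2 + 5 * q ^ 2) = (y ^ 3) ^ 2 * k ^ 3 := by
      calc (y ^ 3) ^ 2 * (p ^ 2 + 5 * q ^ 2) = (y ^ 3 * p) ^ 2 + 5 * (y ^ 3 * q) ^ 2 := by ring
        _ = (P ^ 2 + 5 * Q ^ 2) * (x ^ 2 + 5 * w ^ 2) := by rw [← hp, ← hq]; ring
        _ = _ := by rw [hPQ, h]; ring
    exact mul_left_cancel₀ (by positivity) this
  have hPx : P = p * x - 5 * q * w := by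
    apply mul_left_cancel₀ hy3
    linear_combination x * hp - 5 * w * hq - P * h
  have hQx : Q = p * w + q * x := by
    apply mul_left_cancel₀ hy3
    linear_combination w * hp + x * hq - Q * h
  rcases hXY with h1 | h2
  · rw [h1] at hN
    obtain ⟨hq0, hp1⟩ := qform_eq_one p q (by simpa using hN)
    subst hq0
    refine ⟨s, Y, ?_⟩
    rw [← hP, ← hQ]
    rcases hp1 with rfl | rfl
    · exact ⟨Or.inl (by linarith), Or.inl (by linarith)⟩
    · exact ⟨Or.inr (by linarith), Or.inr (by linarith)⟩
  · exfalso
    rw [h2] at hN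
    exact qform_ne_eight p q (by simpa using hN)

theorem eq_x_sq_add_5a_11b_ne_y_cubed_special (x y : ℤ) (a b : ℕ) (hx : x ≠ 0)
    (ha : a % 6 = 5) (hb : b % 6 = 4) (hcop : Int.gcd x 55 = 1) :
    x ^ 2 + 5 ^ a * 11 ^ b ≠ y ^ 3 := by
  intro h
  obtain ⟨c, rfl⟩ : ∃ c, a = 2 * c + 1 := ⟨a / 2, by omega⟩
  obtain ⟨d, rfl⟩ : ∃ d, b = 2 * d := ⟨b / 2, by omega⟩
  have hc55 : IsCoprime x (5 * 11) := Int.isCoprime_iff_gcd_eq_one.2 hcop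
  have hc5 : IsCoprime x 5 := hc55.of_mul_right_left
  have hc11 : IsCoprime x 11 := hc55.of_mul_right_right
  obtain ⟨w, hw⟩ : ∃ w : ℤ, w = 5 ^ c * 11 ^ d := ⟨_, rfl⟩
  have hxw : IsCoprime x w := by rw [hw]; exact (hc5.pow_right).mul_right hc11.pow_right
  have h' : x ^ 2 + 5 * w ^ 2 = y ^ 3 := by rw [← h, hw]; ring
  have hwy : IsCoprime w (y ^ 3) := by
    rw [← h']
    have : IsCoprime w (x ^ 2 + w * (5 * w)) := (hxw.symm.pow_right).add_mul_left_right _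
    convert this using 1; ring
  have hy : 0 < y := by
    by_contra hn
    have : 0 < x ^ 2 := by positivity
    have h3 : y ^ 3 ≤ 0 := Odd.pow_nonpos (by decide) (not_lt.1 hn)
    nlinarith [sq_nonneg w]
  obtain ⟨s, t, hxs, hwt⟩ := cube_descent_s4 x w y hy hwy h'
  have hsx : s ∣ x := by
    rcases hxs with e | e <;> rw [e]
    · exact dvd_mul_right _ _
    · exact (dvd_mul_right _ _).neg_right
  have hs5 : IsCoprime s 5 := hc5.of_isCoprime_of_dvd_left hsx
  obtain ⟨g, hg⟩ : ∃ g, g = 3 * s ^ 2 - 5 * t ^ 2 := ⟨_, rfl⟩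
  rw [← hg] at hwt
  have hgw : g ∣ 5 ^ c * 11 ^ d := by
    rw [← hw]
    rcases hwt with e | e <;> rw [e]
    · exact dvd_mul_left _ _
    · exact (dvd_mul_left _ _).neg_right
  have hsm : s % 5 = 1 ∨ s % 5 = 2 ∨ s % 5 = 3 ∨ s % 5 = 4 := by
    have : s % 5 ≠ 0 := by
      intro h0
      have := hs5.isUnit_of_dvd' (Int.dvd_of_emod_eq_zero h0) dvd_rfl
      rw [Int.isUnit_iff] at this
      omega
    omega
  have hgm : g % 5 = 2 ∨ g % 5 = 3 := by
    rw [hg]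
    have : s ^ 2 % 5 = 1 ∨ s ^ 2 % 5 = 4 := by
      rcases hsm with e | e | e | e <;> simp [pow_two, Int.mul_emod, e]
    omega
  have hg5 : IsCoprime g 5 := by
    rcases hgm with e | e
    · exact ⟨-2, 2 * (g / 5) + 1, by omega⟩
    · exact ⟨2, -(2 * (g / 5) + 1), by omega⟩
  have hg11 : g ∣ 11 ^ d := (hg5.pow_right).dvd_of_dvd_mul_left hgw
  obtain ⟨i, -, hi⟩ := (dvd_prime_pow (by norm_num : Prime (11 : ℤ)) d).1 hg11
  have h11 : (11 : ℤ) ^ i % 5 = 1 := by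
    have := (show (11 : ℤ) ≡ 1 [ZMOD 5] by decide).pow i
    simpa [Int.ModEq] using this
  rcases Int.associated_iff.1 hi with e | e <;> omega
end

section
/- The Thue–Mahler equation x⁴ + 4398·x³y + 7250100·x²y² + 5309489900·xy³ + 1457454977550·y⁴ = 2·13⁶·5^c·11^d has no solutions in integers x, y with gcd(x,y) = 1 and nonnegative integers c, d. -/
/-- Division step in `ℤ[√-D]`. -/
lemma tm_step (D a b h t M N : ℤ) (hh : 0 < h) (hab : a ^ 2 + D * b ^ 2 = h)
    (hN : t ^ 2 + D * M ^ 2 = h * N) (hcop : IsCoprime M h) (hdiv : h ∣ a * M - t * b) :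
    ∃ t1 M1 : ℤ, t = t1 * a - D * M1 * b ∧ M = t1 * b + M1 * a ∧ t1 ^ 2 + D * M1 ^ 2 = N := by
  obtain ⟨M1, hM1⟩ := hdiv
  have h2 : h ∣ t * a + D * M * b := by
    have : h ∣ M * (t * a + D * M * b) := by
      refine ⟨t * M1 + N * b, ?_⟩
      linear_combination t * hM1 + b * hN
    exact (hcop.symm).dvd_of_dvd_mul_left this
  obtain ⟨t1, ht1⟩ := h2
  have hne : h ≠ 0 := hh.ne'
  refine ⟨t1, M1, ?_, ?_, ?_⟩
  · apply mul_left_cancel₀ hne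
    linear_combination (-t) * hab + a * ht1 - D * b * hM1
  · apply mul_left_cancel₀ hne
    linear_combination (-M) * hab + b * ht1 + a * hM1
  · apply mul_left_cancel₀ (mul_ne_zero hne hne)
    linear_combination h * hN + (t ^ 2 + D * M ^ 2) * hab
      - (t * a + D * M * b + h * t1) * ht1 - D * (a * M - t * b + h * M1) * hM1

/-- The divisibility needed for the next division step. -/
lemma tm_next (D a b h t1 M1 N M : ℤ) (hab : a ^ 2 + D * b ^ 2 = h)
    (hN : t1 ^ 2 + D * M1 ^ 2 = h * N) (hM : M = t1 * b + M1 * a) (hcop : IsCoprime M h) :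
    h ∣ a * M1 - t1 * b := by
  have : h ∣ M * (a * M1 - t1 * b) := by
    refine ⟨M1 ^ 2 - N * b ^ 2, ?_⟩
    rw [hM]
    linear_combination M1 ^ 2 * hab - b ^ 2 * hN
  exact (hcop.symm).dvd_of_dvd_mul_left this

/-- If `h` is a norm through the right lattice, then we get a cube. -/
lemma tm_cube (D a b h t M : ℤ) (hh : 0 < h) (hab : a ^ 2 + D * b ^ 2 = h)
    (hN : t ^ 2 + D * M ^ 2 = h ^ 3) (hcop : IsCoprime M h) (hdiv : h ∣ a * M - t * b) :
    ∃ t3 M3 : ℤ, t3 ^ 2 + D * M3 ^ 2 = 1 ∧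
      M = t3 * (b * (3 * a ^ 2 - D * b ^ 2)) + M3 * (a * (a ^ 2 - 3 * D * b ^ 2)) := by
  obtain ⟨t1, M1, e1, e2, e3⟩ := tm_step D a b h t M (h * h) hh hab (by rw [hN]; ring) hcop hdiv
  have hd1 := tm_next D a b h t1 M1 h M hab e3 e2 hcop
  have aux : ∀ (p q P N : ℤ), p ^ 2 + D * q ^ 2 = h * N → P = p * b + q * a →
      IsCoprime P h → h ∣ a * q - p * b → IsCoprime q h := by
    intro p q P N h1 h2 h3 h4
    rw [Int.isCoprime_iff_gcd_eq_one, Int.gcd_eq_natAbs, ← Nat.Coprime,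
      ] at *
    refine Nat.coprime_of_dvd ?_
    intro r hr hrq hrh
    have hrq' : (r : ℤ) ∣ q := Int.natCast_dvd.mpr hrq
    have hrh' : (r : ℤ) ∣ h := Int.natCast_dvd.mpr hrh
    have hrp : (r : ℤ) ∣ p ^ 2 := by
      have : p ^ 2 = h * N - q * (D * q) := by linear_combination h1
      rw [this]
      exact dvd_sub (hrh'.mul_right _) (hrq'.mul_right _)
    have hrp' : (r : ℤ) ∣ p := (Nat.prime_iff_prime_int.mp hr).dvd_of_dvd_pow hrp
    have hP : (r : ℤ) ∣ P := by
      rw [h2]; exact dvd_add (hrp'.mul_right _) (hrq'.mul_right _)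
    exact Nat.not_coprime_of_dvd_of_dvd hr.one_lt (Int.natCast_dvd.mp hP) hrh h3
  have hc1 := aux t1 M1 M h e3 e2 hcop hd1
  obtain ⟨t2, M2, f1, f2, f3⟩ := tm_step D a b h t1 M1 h hh hab e3 hc1 hd1
  have hd2 := tm_next D a b h t2 M2 1 M1 hab (by rw [f3]; ring) f2 hc1
  have hc2 := aux t2 M2 M1 1 (by rw [f3]; ring) f2 hc1 hd2
  obtain ⟨t3, M3, g1, g2, g3⟩ := tm_step D a b h t2 M2 1 hh hab (by rw [f3]; ring) hc2 hd2
  refine ⟨t3, M3, g3, ?_⟩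
  rw [e2, f1, f2, g1, g2]
  ring

/-- Lemma of Thue. -/
lemma tm_thue (h t M : ℤ) (hh : 0 < h) :
    ∃ a b : ℤ, (a ≠ 0 ∨ b ≠ 0) ∧ a ^ 2 ≤ h ∧ b ^ 2 < h ∧ h ∣ a * M - t * b := by
  obtain ⟨n, rfl⟩ := Int.eq_ofNat_of_zero_le hh.le
  have hn : 0 < n := by exact_mod_cast hh
  have : NeZero n := ⟨hn.ne'⟩
  set A := Nat.sqrt n with hA
  set B := Nat.sqrt (n - 1) with hB
  have A1 : A * A ≤ n := Nat.sqrt_le n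
  have A2 : n < (A + 1) * (A + 1) := Nat.lt_succ_sqrt n
  have B1 : B * B ≤ n - 1 := Nat.sqrt_le _
  have B2 : n - 1 < (B + 1) * (B + 1) := Nat.lt_succ_sqrt _
  have hcard : n < (A + 1) * (B + 1) := by
    have B3 : n ≤ (B + 1) * (B + 1) := by omega
    by_contra hcon
    push Not at hcon
    have h1 : ((A + 1) * (B + 1)) * ((A + 1) * (B + 1)) ≤ n * n := Nat.mul_le_mul hcon hcon
    have h2 : n * n < ((A + 1) * (A + 1)) * ((B + 1) * (B + 1)) :=
      Nat.mul_lt_mul_of_lt_of_le A2 B3 (by omega)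
    nlinarith
  let f : ℕ × ℕ → ZMod n := fun p => (p.1 : ZMod n) * (M : ZMod n) - (t : ZMod n) * (p.2 : ZMod n)
  obtain ⟨p, hp, q, hq, hpq, hfe⟩ := Finset.exists_ne_map_eq_of_card_lt_of_maps_to
    (s := Finset.range (A + 1) ×ˢ Finset.range (B + 1)) (t := (Finset.univ : Finset (ZMod n)))
    (f := f) (by simpa [ZMod.card] using hcard) (by intro x _; simp)
  simp only [Finset.mem_product, Finset.mem_range] at hp hq
  have habs : ∀ (x y C : ℕ), x < C + 1 → y < C + 1 → ((x : ℤ) - y) ^ 2 ≤ (C : ℤ) * C := by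
    intro x y C hx hy
    have h1 : (x : ℤ) ≤ C := by omega
    have h2 : (y : ℤ) ≤ C := by omega
    have h3 : (0 : ℤ) ≤ x := by omega
    have h4 : (0 : ℤ) ≤ y := by omega
    nlinarith [mul_nonneg (show (0:ℤ) ≤ C - (x - y) by linarith) (show (0:ℤ) ≤ C + (x - y) by linarith)]
  refine ⟨(p.1 : ℤ) - q.1, (p.2 : ℤ) - q.2, ?_, ?_, ?_, ?_⟩
  · by_contra hcon
    push Not at hcon
    apply hpq
    ext
    · have := hcon.1; omega
    · have := hcon.2; omega
  · refine (habs _ _ A hp.1 hq.1).trans ?_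
    exact_mod_cast A1
  · refine (habs _ _ B hp.2 hq.2).trans_lt ?_
    have : B * B < n := by omega
    exact_mod_cast this
  · have : (((((p.1 : ℤ) - q.1) * M - t * ((p.2 : ℤ) - q.2) : ℤ)) : ZMod n) = 0 := by
      push_cast
      have hfe' : (p.1 : ZMod n) * (M : ZMod n) - (t : ZMod n) * (p.2 : ZMod n) =
        (q.1 : ZMod n) * (M : ZMod n) - (t : ZMod n) * (q.2 : ZMod n) := hfe
      linear_combination hfe'
    exact (ZMod.intCast_zmod_eq_zero_iff_dvd _ n).mp this

lemma tm_norm1 (t M h : ℤ) (hh : 0 < h) (hN : t ^ 2 + 1 * M ^ 2 = h ^ 3) (hcop : IsCoprime M h) :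
    ∃ a b : ℤ, a ^ 2 + 1 * b ^ 2 = h ∧ h ∣ a * M - t * b := by
  obtain ⟨a, b, h0, ha, hb, k, hk⟩ := tm_thue h t M hh
  refine ⟨a, b, ?_, ⟨k, hk⟩⟩
  have : h ∣ a ^ 2 + b ^ 2 := by
    have : h ∣ M ^ 2 * (a ^ 2 + b ^ 2) := by
      refine ⟨k * (a * M + t * b) + h ^ 2 * b ^ 2, ?_⟩
      linear_combination (a * M + t * b) * hk + b ^ 2 * hN
    exact (hcop.pow_left (m := 2)).symm.dvd_of_dvd_mul_left this
  obtain ⟨l, hl⟩ := this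
  have hpos : 0 < a ^ 2 + b ^ 2 := by rcases h0 with h0 | h0 <;> positivity
  have l1 : 0 < l := by
    by_contra hcon
    nlinarith
  have l2 : l < 2 := by
    by_contra hcon
    nlinarith
  have : l = 1 := by omega
  subst this
  linarith

lemma tm_even (a b h : ℤ) (hl : a ^ 2 + 5 * b ^ 2 = h * 4) : a % 2 = 0 ∧ b % 2 = 0 := by
  rcases Int.even_or_odd' a with ⟨p, rfl | rfl⟩ <;> rcases Int.even_or_odd' b with ⟨q, rfl | rfl⟩
  · omega
  · exfalso; ring_nf at hl; omega
  · exfalso; ring_nf at hl; omega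
  · exfalso; ring_nf at hl; omega

lemma tm_mod5 (D a b : ℤ) (hD : D = 1 ∨ D = 5) (h1 : (5 : ℤ) ∣ b * (3 * a ^ 2 - D * b ^ 2))
    (h2 : ¬ (5 : ℤ) ∣ a ^ 2 + D * b ^ 2) :
    (3 * a ^ 2 - D * b ^ 2) % 5 = 2 ∨ (3 * a ^ 2 - D * b ^ 2) % 5 = 3 := by
  have key : ∀ D a b : ZMod 5, (D = 1 ∨ D = 0) → b * (3 * a ^ 2 - D * b ^ 2) = 0 →
      a ^ 2 + D * b ^ 2 ≠ 0 → (3 * a ^ 2 - D * b ^ 2) = 2 ∨ (3 * a ^ 2 - D * b ^ 2) = 3 := by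
    decide
  have h := key D a b (by rcases hD with rfl | rfl
                          · left; simp
                          · right; rfl)
    (by have := (ZMod.intCast_zmod_eq_zero_iff_dvd _ 5).mpr h1
        push_cast at this; exact this)
    (by intro hc
        apply h2
        apply (ZMod.intCast_zmod_eq_zero_iff_dvd _ 5).mp
        push_cast; exact hc)
  rcases h with h | h
  · left
    have : ((3 * a ^ 2 - D * b ^ 2 : ℤ) : ZMod 5) = ((2 : ℤ) : ZMod 5) := by push_cast; exact h
    exact (ZMod.intCast_eq_intCast_iff' _ _ 5).mp this
  · right
    have : ((3 * a ^ 2 - D * b ^ 2 : ℤ) : ZMod 5) = ((3 : ℤ) : ZMod 5) := by push_cast; exact h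
    exact (ZMod.intCast_eq_intCast_iff' _ _ 5).mp this

lemma tm_norm5 (t M h : ℤ) (hh : 0 < h) (hodd : h % 2 = 1) (h5 : (5 : ℤ) ∣ M)
    (hN : t ^ 2 + 5 * M ^ 2 = h ^ 3) (hcop : IsCoprime M h) :
    ∃ a b : ℤ, a ^ 2 + 5 * b ^ 2 = h ∧ h ∣ a * M - t * b := by
  obtain ⟨a, b, h0, ha, hb, k, hk⟩ := tm_thue h t M hh
  have h5h : IsCoprime (5 : ℤ) h := hcop.of_isCoprime_of_dvd_left h5
  have h5n : h % 5 ≠ 0 := by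
    intro hc
    have h1 : (5 : ℤ) ∣ h := Int.dvd_of_emod_eq_zero hc
    have := h5h.isUnit_of_dvd' (dvd_refl 5) h1
    rw [Int.isUnit_iff] at this
    omega
  have hth : IsCoprime t h := by
    have h1 : IsCoprime (5 * M ^ 2) h := h5h.mul_left hcop.pow_left
    obtain ⟨u, v, huv⟩ := h1
    have h2 : IsCoprime (t * t) h := ⟨-u, v + u * h ^ 2, by linear_combination huv - u * hN⟩
    exact h2.of_mul_left_left
  have : h ∣ a ^ 2 + 5 * b ^ 2 := by
    have : h ∣ M ^ 2 * (a ^ 2 + 5 * b ^ 2) := by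
      refine ⟨k * (a * M + t * b) + h ^ 2 * b ^ 2, ?_⟩
      linear_combination (a * M + t * b) * hk + b ^ 2 * hN
    exact (hcop.pow_left (m := 2)).symm.dvd_of_dvd_mul_left this
  obtain ⟨l, hl⟩ := this
  have hpos : 0 < a ^ 2 + 5 * b ^ 2 := by rcases h0 with h0 | h0 <;> positivity
  have l1 : 0 < l := by
    by_contra hcon
    nlinarith
  have l2 : l < 6 := by
    by_contra hcon
    nlinarith
  -- quadratic residue information modulo 5
  have hres : h % 5 = 1 ∨ h % 5 = 4 := by
    obtain ⟨m, rfl⟩ := h5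
    have e : t ^ 2 % 5 = h ^ 3 % 5 := by
      rw [← hN]; ring_nf; omega
    have ht : t % 5 = 0 ∨ t % 5 = 1 ∨ t % 5 = 2 ∨ t % 5 = 3 ∨ t % 5 = 4 := by omega
    have hhm : h % 5 = 1 ∨ h % 5 = 2 ∨ h % 5 = 3 ∨ h % 5 = 4 := by omega
    rcases ht with ht | ht | ht | ht | ht <;> rcases hhm with hhm | hhm | hhm | hhm <;>
      simp [pow_succ, Int.mul_emod, ht, hhm] at e ⊢
  have ha5 : a % 5 = 0 ∨ a % 5 = 1 ∨ a % 5 = 2 ∨ a % 5 = 3 ∨ a % 5 = 4 := by omega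
  have hsq : a ^ 2 % 5 = 0 ∨ a ^ 2 % 5 = 1 ∨ a ^ 2 % 5 = 4 := by
    rcases ha5 with h | h | h | h | h <;> simp [pow_succ, Int.mul_emod, h]
  have hl' : l = 1 ∨ l = 2 ∨ l = 3 ∨ l = 4 ∨ l = 5 := by omega
  rcases hl' with rfl | rfl | rfl | rfl | rfl
  · exact ⟨a, b, by linarith, k, hk⟩
  · exfalso; omega
  · exfalso; omega
  · -- both even
    have hev : a % 2 = 0 ∧ b % 2 = 0 := by
      exact tm_even a b h hl
    obtain ⟨a', rfl⟩ := Int.dvd_of_emod_eq_zero hev.1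
    obtain ⟨b', rfl⟩ := Int.dvd_of_emod_eq_zero hev.2
    refine ⟨a', b', by linarith, ?_⟩
    have h2h : IsCoprime h 2 := ⟨1, -(h / 2), by omega⟩
    refine h2h.dvd_of_dvd_mul_left ?_
    exact ⟨k, by linear_combination hk⟩
  · have : (5 : ℤ) ∣ a := by
      have h1 : a ^ 2 % 5 = 0 := by omega
      exact Int.Prime.dvd_pow' Nat.prime_five (Int.dvd_of_emod_eq_zero h1)
    obtain ⟨a', rfl⟩ := this
    refine ⟨b, -a', by linarith, ?_⟩
    refine hth.symm.dvd_of_dvd_mul_left ?_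
    exact ⟨h ^ 2 * a' - M * k, by linear_combination a' * hN - M * hk⟩

/-- Contradiction modulo 5. -/
lemma tm_final (D a b h M : ℤ) (m n e : ℕ) (he : e = 0 ∨ e = 12) (hm : 0 < m)
    (hD : D = 1 ∨ D = 5) (hab : a ^ 2 + D * b ^ 2 = h) (hcop : IsCoprime M h)
    (hM : M = 5 ^ m * (11 ^ n * 13 ^ e)) (hMe : M = b * (3 * a ^ 2 - D * b ^ 2)) : False := by
  set W := 3 * a ^ 2 - D * b ^ 2 with hW
  have h5M : (5 : ℤ) ∣ M := by
    rw [hM]; exact (dvd_pow_self 5 hm.ne').mul_right _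
  have h5h : ¬ (5 : ℤ) ∣ h := by
    intro h1
    have := hcop.isUnit_of_dvd' h5M h1
    rw [Int.isUnit_iff] at this
    omega
  have hbh : IsCoprime b h := hcop.of_isCoprime_of_dvd_left ⟨W, hMe⟩
  have hba : IsCoprime b (a ^ 2) := by
    obtain ⟨u, v, huv⟩ := hbh
    exact ⟨u + v * D * b, v, by rw [← hab] at huv; linear_combination huv⟩
  have hM3 : IsCoprime M 3 := by
    rw [hM]
    have c5 : IsCoprime (5 : ℤ) 3 := ⟨-1, 2, by norm_num⟩
    have c11 : IsCoprime (11 : ℤ) 3 := ⟨-1, 4, by norm_num⟩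
    have c13 : IsCoprime (13 : ℤ) 3 := ⟨1, -4, by norm_num⟩
    exact c5.pow_left.mul_left (c11.pow_left.mul_left c13.pow_left)
  have hb3 : IsCoprime b 3 := hM3.of_isCoprime_of_dvd_left ⟨W, hMe⟩
  have hbW : IsCoprime b W := by
    obtain ⟨u, v, huv⟩ := hb3.mul_right hba
    exact ⟨u + v * D * b, v, by rw [hW]; linear_combination huv⟩
  have key : W % 5 = 2 ∨ W % 5 = 3 := by
    have e1 : (5 : ℤ) ∣ b * W := by rw [← hMe]; exact h5M
    exact tm_mod5 D a b hD e1 (by rw [hab]; exact h5h)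
  have h5W : IsCoprime W 5 := by
    rcases key with h1 | h1
    · exact ⟨-2, 2 * (W / 5) + 1, by omega⟩
    · exact ⟨2, -2 * (W / 5) - 1, by omega⟩
  have hWd : W ∣ 11 ^ n * 13 ^ e := by
    have : W ∣ 5 ^ m * (11 ^ n * 13 ^ e) := by
      rw [← hM, hMe]; exact dvd_mul_left _ _
    exact h5W.pow_right.dvd_of_dvd_mul_left this
  have hWn : W.natAbs ∣ 11 ^ n * 13 ^ e := by
    have := Int.natAbs_dvd_natAbs.mpr hWd
    simpa [Int.natAbs_mul, Int.natAbs_pow] using this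
  obtain ⟨w1, w2, hw1, hw2, hw⟩ := (Nat.dvd_mul).mp hWn
  obtain ⟨i, hi, rfl⟩ := (Nat.dvd_prime_pow (by norm_num : Nat.Prime 11)).mp hw1
  obtain ⟨j, hj, rfl⟩ := (Nat.dvd_prime_pow (by norm_num : Nat.Prime 13)).mp hw2
  have hj' : j = 0 ∨ j = 12 := by
    rcases he with rfl | rfl
    · omega
    · by_contra hcon
      push Not at hcon
      have h13W : (13 : ℤ) ∣ W := by
        rw [← Int.dvd_natAbs, ← hw]
        push_cast
        exact (dvd_pow_self 13 hcon.1).mul_left _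
      have hc : IsCoprime b 13 := hbW.of_isCoprime_of_dvd_right h13W
      have hd : (13 : ℤ) ^ 12 ∣ b * W := by
        rw [← hMe, hM]; exact (dvd_mul_left _ _).mul_left _
      have hd2 : (13 : ℤ) ^ 12 ∣ W := hc.symm.pow_left.dvd_of_dvd_mul_left hd
      have hd3 : 13 ^ 12 ∣ 11 ^ i * 13 ^ j := by
        rw [hw]
        have := Int.natAbs_dvd_natAbs.mpr hd2
        simpa [Int.natAbs_pow] using this
      have hd4 : 13 ^ 12 ∣ 13 ^ j := by
        refine Nat.Coprime.dvd_of_dvd_mul_left ?_ hd3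
        exact Nat.Coprime.pow _ _ (by norm_num)
      have h12 := (Nat.pow_dvd_pow_iff_le_right (by norm_num : 1 < 13)).mp hd4
      exact hcon.2 (le_antisymm hj h12)
  have hmod : W.natAbs % 5 = 1 := by
    rw [← hw]
    rcases hj' with rfl | rfl <;> simp [Nat.mul_mod, Nat.pow_mod]
  omega

lemma tm_core (D t M h : ℤ) (m n e : ℕ) (he : e = 0 ∨ e = 12) (hm : 0 < m)
    (hD : D = 1 ∨ D = 5) (hodd : h % 2 = 1) (hcop : IsCoprime M h)
    (hM : M = 5 ^ m * (11 ^ n * 13 ^ e)) (hN : t ^ 2 + D * M ^ 2 = h ^ 3) : False := by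
  have hMpos : 0 < M := by rw [hM]; positivity
  have hh : 0 < h := by
    have : 0 < h ^ 3 := by
      rw [← hN]; rcases hD with rfl | rfl <;> positivity
    by_contra hcon
    push Not at hcon
    have := Odd.pow_nonpos (n := 3) (by decide) hcon
    omega
  have h5M : (5 : ℤ) ∣ M := by
    rw [hM]; exact (dvd_pow_self 5 hm.ne').mul_right _
  rcases hD with rfl | rfl
  · obtain ⟨a, b, hab, hdiv⟩ := tm_norm1 t M h hh hN hcop
    obtain ⟨t3, M3, e1, e2⟩ := tm_cube 1 a b h t M hh hab hN hcop hdiv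
    have ht3 : -1 ≤ t3 ∧ t3 ≤ 1 := by constructor <;> nlinarith [sq_nonneg M3]
    have hM3 : -1 ≤ M3 ∧ M3 ≤ 1 := by constructor <;> nlinarith [sq_nonneg t3]
    obtain ⟨p1, p2⟩ := ht3
    obtain ⟨q1, q2⟩ := hM3
    interval_cases t3 <;> interval_cases M3 <;> first | (exfalso; omega) | skip
    · exact tm_final 1 (-a) (-b) h M m n e he hm (Or.inl rfl) (by rw [← hab]; ring) hcop hM
        (by rw [e2]; ring)
    · exact tm_final 1 b a h M m n e he hm (Or.inl rfl) (by rw [← hab]; ring) hcop hM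
        (by rw [e2]; ring)
    · exact tm_final 1 (-b) (-a) h M m n e he hm (Or.inl rfl) (by rw [← hab]; ring) hcop hM
        (by rw [e2]; ring)
    · exact tm_final 1 a b h M m n e he hm (Or.inl rfl) (by rw [← hab]) hcop hM
        (by rw [e2]; ring)
  · obtain ⟨a, b, hab, hdiv⟩ := tm_norm5 t M h hh hodd h5M hN hcop
    obtain ⟨t3, M3, e1, e2⟩ := tm_cube 5 a b h t M hh hab hN hcop hdiv
    have hM3 : M3 = 0 := by
      have q1 : -1 < M3 := by nlinarith [sq_nonneg t3]
      have q2 : M3 < 1 := by nlinarith [sq_nonneg t3]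
      omega
    subst hM3
    have ht3 : t3 = 1 ∨ t3 = -1 := by
      have : t3 ^ 2 = 1 := by linarith
      rcases mul_eq_zero.mp (show (t3 - 1) * (t3 + 1) = 0 by linarith) with h | h
      · left; linarith
      · right; linarith
    rcases ht3 with rfl | rfl
    · exact tm_final 5 a b h M m n e he hm (Or.inr rfl) (by rw [← hab]) hcop hM
        (by rw [e2]; ring)
    · exact tm_final 5 (-a) (-b) h M m n e he hm (Or.inr rfl) (by rw [← hab]; ring) hcop hM
        (by rw [e2]; ring)

/-- Splitting by the parity of `c`, for odd `d`. -/
lemma tm_split (t h : ℤ) (c k e : ℕ) (he : e = 0 ∨ e = 12) (hodd : h % 2 = 1)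
    (h5 : ¬ (5 : ℤ) ∣ h) (h11 : ¬ (11 : ℤ) ∣ h) (h13 : e = 0 ∨ ¬ (13 : ℤ) ∣ h)
    (hN : t ^ 2 + 275 * (13 ^ e) ^ 2 * (5 ^ c * 11 ^ (2 * k + 1)) ^ 3 = h ^ 3) : False := by
  have c5 : IsCoprime (5 : ℤ) h :=
    (Int.prime_iff_natAbs_prime.mpr (by norm_num)).coprime_iff_not_dvd.mpr h5
  have c11 : IsCoprime (11 : ℤ) h :=
    (Int.prime_iff_natAbs_prime.mpr (by norm_num)).coprime_iff_not_dvd.mpr h11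
  have c13 : IsCoprime ((13 : ℤ) ^ e) h := by
    rcases h13 with rfl | h13
    · simpa using isCoprime_one_left
    · exact ((Int.prime_iff_natAbs_prime.mpr (by norm_num)).coprime_iff_not_dvd.mpr h13).pow_left
  have hc : ∀ m n : ℕ, IsCoprime ((5 : ℤ) ^ m * (11 ^ n * 13 ^ e)) h := fun m n =>
    c5.pow_left.mul_left (c11.pow_left.mul_left c13)
  rcases Nat.even_or_odd' c with ⟨i, rfl | rfl⟩
  · refine tm_core 1 t _ h (1 + 3 * i) (3 * k + 2) e he (by omega) (Or.inl rfl) hodd (hc _ _) rfl ?_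
    rw [← hN]; ring
  · refine tm_core 5 t _ h (2 + 3 * i) (3 * k + 2) e he (by omega) (Or.inr rfl) hodd (hc _ _) rfl ?_
    rw [← hN]; ring

lemma tm_eleven (y A : ℤ) (c k : ℕ) (hy : ¬ (11 : ℤ) ∣ y)
    (h : 11 * A + 132495907050 * y ^ 4 = 2 * 13 ^ 6 * 5 ^ c * (11 ^ k) ^ 2) : False := by
  have key : ∀ y z : ZMod 11, y ≠ 0 → y ^ 4 ≠ 7 * z ^ 2 := by decide
  have hy0 : (y : ZMod 11) ≠ 0 := fun hc => hy ((ZMod.intCast_zmod_eq_zero_iff_dvd _ 11).mp hc)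
  refine key y (4 ^ c * 11 ^ k) hy0 ?_
  have h2 := congrArg (Int.cast : ℤ → ZMod 11) h
  push_cast at h2
  have e1 : (11 : ZMod 11) = 0 := by decide
  have e2 : (132495907050 : ZMod 11) = 1 := by
    have : ((132495907050 : ℤ) : ZMod 11) = ((1 : ℤ) : ZMod 11) :=
      (ZMod.intCast_eq_intCast_iff' _ _ 11).mpr (by norm_num)
    exact_mod_cast this
  have e3 : (9653618 : ZMod 11) = 7 := by
    have : ((9653618 : ℤ) : ZMod 11) = ((7 : ℤ) : ZMod 11) :=
      (ZMod.intCast_eq_intCast_iff' _ _ 11).mpr (by norm_num)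
    exact_mod_cast this
  have e4 : (5 : ZMod 11) ^ c = (4 ^ c) ^ 2 := by
    rw [← pow_mul, mul_comm, pow_mul]; congr 1
  rw [e2, e3, e4] at h2
  rw [e1] at h2 ⊢
  linear_combination h2

lemma tm_not_dvd (p : ℕ) (hp : p.Prime) (h C X B : ℤ) (hh : h = C * X ^ 4 + p * B)
    (hC : ¬ (p : ℤ) ∣ C) (hX : ¬ (p : ℤ) ∣ X) : ¬ (p : ℤ) ∣ h := by
  intro hd
  have hp' : Prime (p : ℤ) := Nat.prime_iff_prime_int.mp hp
  have h1 : (p : ℤ) ∣ C * X ^ 4 := by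
    have : C * X ^ 4 = h - p * B := by linarith
    rw [this]; exact dvd_sub hd (dvd_mul_right _ _)
  rcases hp'.dvd_or_dvd h1 with h2 | h2
  · exact hC h2
  · exact hX (hp'.dvd_of_dvd_pow h2)

theorem thue_mahler_no_solution (x y : ℤ) (hcop : Int.gcd x y = 1) (c d : ℕ) :
    x ^ 4 + 4398 * x ^ 3 * y + 7250100 * x ^ 2 * y ^ 2 + 5309489900 * x * y ^ 3 +
      1457454977550 * y ^ 4 ≠ 2 * 13 ^ 6 * 5 ^ c * 11 ^ d := by
  intro hF
  have hnot : ∀ p : ℕ, p.Prime → (p : ℤ) ∣ x → ¬ (p : ℤ) ∣ y := by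
    intro p hp h1 h2
    have h3 := Int.dvd_coe_gcd h1 h2
    rw [hcop] at h3
    have h4 : p ∣ 1 := by exact_mod_cast h3
    exact hp.one_lt.ne' (Nat.dvd_one.mp h4)
  -- `x` is even
  have hx2 : (2 : ℤ) ∣ x := by
    have : (2 : ℤ) ∣ x ^ 4 := by
      refine ⟨13 ^ 6 * 5 ^ c * 11 ^ d - (2199 * x ^ 3 * y + 3625050 * x ^ 2 * y ^ 2
        + 2654744950 * x * y ^ 3 + 728727488775 * y ^ 4), ?_⟩
      linear_combination hF
    exact Int.Prime.dvd_pow' Nat.prime_two this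
  have hy2 : ¬ (2 : ℤ) ∣ y := hnot 2 Nat.prime_two hx2
  obtain ⟨X, rfl⟩ := hx2
  obtain ⟨q, hq⟩ : ∃ q, y = 2 * q + 1 := ⟨y / 2, by omega⟩
  have hy4 : ∃ r, y ^ 4 = 4 * r + 1 := ⟨4 * q ^ 4 + 8 * q ^ 3 + 6 * q ^ 2 + 2 * q, by rw [hq]; ring⟩
  obtain ⟨r, hr⟩ := hy4
  have hF2 : 8 * X ^ 4 + 17592 * X ^ 3 * y + 14500200 * X ^ 2 * y ^ 2 + 5309489900 * X * y ^ 3 +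
      728727488775 * y ^ 4 = 13 ^ 6 * (5 ^ c * 11 ^ d) := by linarith
  -- `d` is odd
  have hd : Odd d := by
    rw [← Nat.not_even_iff_odd]
    rintro ⟨k, rfl⟩
    have e5 : ∃ u : ℤ, (5 : ℤ) ^ c = 4 * u + 1 := by
      have : (4 : ℤ) ∣ 5 ^ c - 1 := by simpa using sub_dvd_pow_sub_pow (5 : ℤ) 1 c
      obtain ⟨u, hu⟩ := this; exact ⟨u, by linarith⟩
    have e11 : ∃ u : ℤ, (11 : ℤ) ^ (k + k) = 4 * u + 1 := by
      have : (120 : ℤ) ∣ 121 ^ k - 1 := by simpa using sub_dvd_pow_sub_pow (121 : ℤ) 1 k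
      obtain ⟨u, hu⟩ := this
      refine ⟨30 * u, ?_⟩
      rw [← two_mul, pow_mul]; norm_num; linarith
    obtain ⟨u, hu⟩ := e5
    obtain ⟨v, hv⟩ := e11
    rw [hu, hv] at hF2
    have : 4 * (2 * X ^ 4 + 4398 * X ^ 3 * y + 3625050 * X ^ 2 * y ^ 2 + 1327372475 * X * y ^ 3
      + 728727488775 * r) + 728727488775 = 4 * (13 ^ 6 * (4 * u * v + u + v)) + 13 ^ 6 := by
      rw [hr] at hF2
      linarith
    omega
  obtain ⟨k, rfl⟩ := hd
  have p11 : Nat.Prime 11 := by norm_num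
  have p13 : Nat.Prime 13 := by norm_num
  -- `5 ∤ x`
  have hX5 : ¬ (5 : ℤ) ∣ X := by
    intro h5
    have hy5 : ¬ (5 : ℤ) ∣ y := hnot 5 Nat.prime_five (h5.mul_left 2)
    obtain ⟨Z, rfl⟩ := h5
    have hy4 : ∃ s, y ^ 4 = 5 * s + 1 := by
      have key : ∀ y : ZMod 5, y ≠ 0 → y ^ 4 - 1 = 0 := by decide
      have h1 := key y (fun hc => hy5 ((ZMod.intCast_zmod_eq_zero_iff_dvd _ 5).mp hc))
      have h2 : ((y ^ 4 - 1 : ℤ) : ZMod 5) = 0 := by push_cast; exact h1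
      obtain ⟨s, hs⟩ := (ZMod.intCast_zmod_eq_zero_iff_dvd _ 5).mp h2
      exact ⟨s, by push_cast at hs; linarith⟩
    obtain ⟨s, hs⟩ := hy4
    have e11 : ∃ u : ℤ, (11 : ℤ) ^ (2 * k + 1) = 5 * u + 1 := by
      have : (10 : ℤ) ∣ 11 ^ (2 * k + 1) - 1 := by
        simpa using sub_dvd_pow_sub_pow (11 : ℤ) 1 (2 * k + 1)
      obtain ⟨u, hu⟩ := this; exact ⟨2 * u, by linarith⟩
    obtain ⟨u, hu⟩ := e11
    rw [hu] at hF2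
    have h1 : 125 * (40 * Z ^ 4 + 17592 * Z ^ 3 * y + 2900040 * Z ^ 2 * y ^ 2
        + 212379596 * Z * y ^ 3 + 29149099551 * s) + 25 * 29149099551
        = 13 ^ 6 * (5 ^ c * (5 * u + 1)) := by
      rw [← hF2, hs]; ring
    generalize (40 * Z ^ 4 + 17592 * Z ^ 3 * y + 2900040 * Z ^ 2 * y ^ 2
        + 212379596 * Z * y ^ 3 + 29149099551 * s) = B at h1
    match c, h1 with
    | 0, h1 => norm_num at h1; omega
    | 1, h1 => norm_num at h1; omega
    | 2, h1 => norm_num at h1; omega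
    | c + 3, h1 =>
      have h2 : (13 : ℤ) ^ 6 * (5 ^ (c + 3) * (5 * u + 1)) = 125 * (13 ^ 6 * 5 ^ c * (5 * u + 1)) := by
        ring
      rw [h2] at h1
      omega
  -- `11 ∤ x`
  have hX11 : ¬ (11 : ℤ) ∣ X := by
    intro h11
    have hy11 : ¬ (11 : ℤ) ∣ y := hnot 11 p11 (h11.mul_left 2)
    obtain ⟨Z, rfl⟩ := h11
    refine tm_eleven y (2 * (4 * 11 ^ 2 * Z ^ 4 + 17592 * 11 * Z ^ 3 * y + 14500200 * Z ^ 2 * y ^ 2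
      + 482680900 * Z * y ^ 3 + 4 * 11 ^ 2 * Z ^ 4)) c k hy11 ?_
    apply mul_left_cancel₀ (show (11 : ℤ) ≠ 0 by norm_num)
    have h1 : (11 : ℤ) ^ (2 * k + 1) = 11 * (11 ^ k) ^ 2 := by ring
    rw [h1] at hF2
    linear_combination 2 * hF2
  by_cases h13 : (13 : ℤ) ∣ X
  · have hy13 : ¬ (13 : ℤ) ∣ y := hnot 13 p13 (h13.mul_left 2)
    obtain ⟨w, rfl⟩ := h13
    have hw : (13 : ℤ) ∣ w := by
      have h1 : (13 : ℤ) ∣ 17592 * (w ^ 3 * y) := by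
        refine ⟨13 ^ 2 * (5 ^ c * 11 ^ (2 * k + 1)) - (8 * w ^ 4 + 13 * 6600 * w ^ 2 * y ^ 2
          + 13 ^ 3 * 1100 * w * y ^ 3 + 13 ^ 2 * 150975 * y ^ 4), ?_⟩
        apply mul_left_cancel₀ (show (13 : ℤ) ^ 3 ≠ 0 by norm_num)
        linear_combination hF2
      have pp : Prime (13 : ℤ) := Nat.prime_iff_prime_int.mp p13
      rcases pp.dvd_or_dvd h1 with h2 | h2
      · omega
      · rcases pp.dvd_or_dvd h2 with h3 | h3
        · exact pp.dvd_of_dvd_pow h3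
        · exact absurd h3 hy13
    obtain ⟨Z, rfl⟩ := hw
    have hS : (5 : ℤ) ^ c * 11 ^ (2 * k + 1) = 1352 * Z ^ 4 + 17592 * Z ^ 3 * y
        + 85800 * Z ^ 2 * y ^ 2 + 185900 * Z * y ^ 3 + 150975 * y ^ 4 := by
      apply mul_left_cancel₀ (show (13 : ℤ) ^ 6 ≠ 0 by norm_num)
      linear_combination -hF2
    have hZ5 : ¬ (5 : ℤ) ∣ Z := fun h => hX5 ((h.mul_left 13).mul_left 13)
    have hZ11 : ¬ (11 : ℤ) ∣ Z := fun h => hX11 ((h.mul_left 13).mul_left 13)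
    refine tm_split (-52792 * Z ^ 6 - 686400 * Z ^ 5 * y - 2788500 * Z ^ 4 * y ^ 2
      + 5500 * Z ^ 3 * y ^ 3 + 29493750 * Z ^ 2 * y ^ 4 + 76683750 * Z * y ^ 5 + 62315000 * y ^ 6)
      (8804 * Z ^ 4 + 114400 * Z ^ 3 * y + 557700 * Z ^ 2 * y ^ 2 + 1208900 * Z * y ^ 3
      + 983125 * y ^ 4) c k 0 (Or.inl rfl) ?_ ?_ ?_ (Or.inl rfl) ?_
    · rw [hr]; ring_nf; omega
    · exact tm_not_dvd 5 Nat.prime_five _ 8804 Z (22880 * Z ^ 3 * y + 111540 * Z ^ 2 * y ^ 2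
        + 241780 * Z * y ^ 3 + 196625 * y ^ 4) (by push_cast; ring) (by norm_num) hZ5
    · exact tm_not_dvd 11 p11 _ 8804 Z (10400 * Z ^ 3 * y + 50700 * Z ^ 2 * y ^ 2
        + 109900 * Z * y ^ 3 + 89375 * y ^ 4) (by push_cast; ring) (by norm_num) hZ11
    · rw [hS]; ring
  · refine tm_split (-52792 * X ^ 6 - 116001600 * X ^ 5 * y - 79642348500 * X ^ 4 * y ^ 2
      + 26547449500 * X ^ 3 * y ^ 3 + 24058957952493750 * X ^ 2 * y ^ 4
      + 10571506124325753750 * X * y ^ 5 + 1451820174407403515000 * y ^ 6)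
      (8804 * X ^ 4 + 19333600 * X ^ 3 * y + 15928469700 * X ^ 2 * y ^ 2
      + 5835129400100 * X * y ^ 3 + 801965265083125 * y ^ 4) c k 12 (Or.inr rfl) ?_ ?_ ?_
      (Or.inr ?_) ?_
    · rw [hr]; ring_nf; omega
    · exact tm_not_dvd 5 Nat.prime_five _ 8804 X (3866720 * X ^ 3 * y + 3185693940 * X ^ 2 * y ^ 2
        + 1167025880020 * X * y ^ 3 + 160393053016625 * y ^ 4) (by push_cast; ring)
        (by norm_num) hX5
    · exact tm_not_dvd 11 p11 _ 8804 X (1757600 * X ^ 3 * y + 1448042700 * X ^ 2 * y ^ 2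
        + 530466309100 * X * y ^ 3 + 72905933189375 * y ^ 4) (by push_cast; ring) (by norm_num) hX11
    · exact tm_not_dvd 13 p13 _ 8804 X (1487200 * X ^ 3 * y + 1225266900 * X ^ 2 * y ^ 2
        + 448856107700 * X * y ^ 3 + 61689635775625 * y ^ 4) (by push_cast; ring) (by norm_num) h13
    · have h1 : (275 : ℤ) * (13 ^ 12) ^ 2 * (5 ^ c * 11 ^ (2 * k + 1)) ^ 3
          = 275 * 13 ^ 6 * (13 ^ 6 * (5 ^ c * 11 ^ (2 * k + 1))) ^ 3 := by ring
      rw [h1, ← hF2]; ring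
end

section
/- The Thue–Mahler equation 150975·X⁴ + 185900·X³Y + 85800·X²Y² + 17592·XY³ + 1352·Y⁴ = 5^c·11^d has no solutions in integers X, Y with gcd(X, 2·13·Y) = 1 (i.e. X odd, X coprime to 13, and gcd(X,Y) = 1) and nonnegative integers c, d. -/
/-- A divisor of `5^a * 11^b` prime to `5` is `±1` modulo `5`. -/
theorem tm_div_mod (M : ℤ) (a b : ℕ) (h : M ∣ 5 ^ a * 11 ^ b) (h5 : ¬ (5 : ℤ) ∣ M) :
    M % 5 = 1 ∨ M % 5 = 4 := by
  have hp : Prime (5 : ℤ) := by norm_num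
  have hc : IsCoprime M (5 ^ a) :=
    ((hp.coprime_iff_not_dvd.mpr h5).symm).pow_right
  have h11 : M ∣ 11 ^ b := hc.dvd_of_dvd_mul_left h
  have hn : M.natAbs ∣ 11 ^ b := by
    have := Int.natAbs_dvd_natAbs.mpr h11
    simpa [Int.natAbs_pow] using this
  obtain ⟨j, -, hj⟩ := (Nat.dvd_prime_pow (by norm_num)).mp hn
  have h1 : ((11 : ℤ) ^ j) % 5 = 1 := by
    have : (11 : ℤ) ^ j ≡ 1 ^ j [ZMOD 5] := Int.ModEq.pow j (by decide)
    rw [one_pow] at this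
    exact this
  have hj' : (M.natAbs : ℤ) = 11 ^ j := by exact_mod_cast hj
  generalize (11 : ℤ) ^ j = T at h1 hj'
  omega

/-- Dirichlet approximation in lattice form. -/
theorem tm_dirichlet (r y : ℤ) (hy : 0 < y) (n : ℕ) (hn : 0 < n) :
    ∃ A B t : ℤ, 0 < B ∧ B ≤ n ∧ A = r * B + y * t ∧ ((n : ℤ) + 1) ^ 2 * A ^ 2 ≤ y ^ 2 := by
  obtain ⟨j, k, hk, hkn, h⟩ := Real.exists_int_int_abs_mul_sub_le ((r : ℝ) / y) hn
  refine ⟨r * k + y * (-j), k, -j, hk, hkn, rfl, ?_⟩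
  have hyR : (0 : ℝ) < y := by exact_mod_cast hy
  have hnR : (0 : ℝ) < (n : ℝ) + 1 := by positivity
  have h2 : ((n : ℝ) + 1) * |(r * k + y * (-j) : ℝ)| ≤ y := by
    have e : (r * k + y * (-j) : ℝ) = y * (k * (r / y) - j) := by
      field_simp
      ring
    rw [e, abs_mul, abs_of_pos hyR]
    rw [le_div_iff₀ hnR] at h
    nlinarith
  have h3 : (((n : ℝ) + 1) * |(r * k + y * (-j) : ℝ)|) ^ 2 ≤ (y : ℝ) ^ 2 :=
    pow_le_pow_left₀ (by positivity) h2 2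
  rw [mul_pow, sq_abs] at h3
  exact_mod_cast h3

/-- The cube identity in `ℤ[√-D]`. -/
theorem tm_cube_s6 (D x w y r q m A B t k : ℤ) (hy : 0 < y) (h : x ^ 2 + D * w ^ 2 = y ^ 3)
    (hx : x = r * w + y ^ 3 * q) (hr : r ^ 2 + D = y ^ 3 * m) (hA : A = r * B + y * t)
    (hk : A ^ 2 + D * B ^ 2 = k * y) :
    ∃ x3 w3 : ℤ, x3 ^ 2 + D * w3 ^ 2 = k ^ 3 ∧
      k ^ 3 * w = x3 * (3 * A ^ 2 * B - D * B ^ 3) + w3 * (A ^ 3 - 3 * D * A * B ^ 2) ∧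
      k ^ 3 * x = x3 * (A ^ 3 - 3 * D * A * B ^ 2) - D * w3 * (3 * A ^ 2 * B - D * B ^ 3) := by
  have hy3 : y ^ 3 ≠ 0 := by positivity
  obtain ⟨P, hP⟩ : ∃ P, P = A ^ 3 - 3 * D * A * B ^ 2 := ⟨_, rfl⟩
  obtain ⟨Q, hQ⟩ : ∃ Q, Q = 3 * A ^ 2 * B - D * B ^ 3 := ⟨_, rfl⟩
  have hPQ : P ^ 2 + D * Q ^ 2 = k ^ 3 * y ^ 3 := by
    rw [← mul_pow, ← hk, hP, hQ]; ring
  rw [← hP, ← hQ]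
  have e1 : r * P + D * Q = y ^ 3 * (m * (B ^ 3 * (r ^ 2 - D) + 3 * B ^ 2 * r * y * t
      + 3 * B * y ^ 2 * t ^ 2) + r * t ^ 3) := by
    rw [hP, hQ, hA]
    linear_combination (B ^ 3 * (r ^ 2 - D) + 3 * B ^ 2 * r * y * t
      + 3 * B * y ^ 2 * t ^ 2) * hr
  have e2 : P - r * Q = y ^ 3 * (m * (-2 * r * B ^ 3 - 3 * B ^ 2 * y * t) + t ^ 3) := by
    rw [hP, hQ, hA]
    linear_combination (-2 * r * B ^ 3 - 3 * B ^ 2 * y * t) * hr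
  generalize (m * (B ^ 3 * (r ^ 2 - D) + 3 * B ^ 2 * r * y * t
      + 3 * B * y ^ 2 * t ^ 2) + r * t ^ 3) = U at e1
  generalize (m * (-2 * r * B ^ 3 - 3 * B ^ 2 * y * t) + t ^ 3) = V at e2
  have f1 : x * P + D * w * Q = y ^ 3 * (w * U + q * P) := by
    linear_combination P * hx + w * e1
  have f2 : w * P - x * Q = y ^ 3 * (w * V - q * Q) := by
    linear_combination (-Q) * hx + w * e2
  generalize w * U + q * P = x3 at f1
  generalize w * V - q * Q = w3 at f2
  refine ⟨x3, w3, ?_, ?_, ?_⟩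
  · apply mul_left_cancel₀ (mul_ne_zero hy3 hy3)
    linear_combination (-(x * P + D * w * Q) - y ^ 3 * x3) * f1
      + (-D * (w * P - x * Q) - D * y ^ 3 * w3) * f2 + (P ^ 2 + D * Q ^ 2) * h + y ^ 3 * hPQ
  · apply mul_left_cancel₀ hy3
    linear_combination Q * f1 + P * f2 - w * hPQ
  · apply mul_left_cancel₀ hy3
    linear_combination P * f1 - D * Q * f2 - x * hPQ

/-- Square root of `-D` modulo `y^3`. -/
theorem tm_root (D x w y : ℤ) (h : x ^ 2 + D * w ^ 2 = y ^ 3) (hc : IsCoprime w y) :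
    ∃ r q m : ℤ, x = r * w + y ^ 3 * q ∧ r ^ 2 + D = y ^ 3 * m := by
  obtain ⟨u, v, huv⟩ := hc.pow_right (n := 3)
  refine ⟨x * u, x * v, u ^ 2 + D * v * (1 + w * u), ?_, ?_⟩
  · linear_combination (-x) * huv
  · linear_combination u ^ 2 * h - D * (1 + w * u) * huv

theorem tm_lattice (D r y m A B t : ℤ) (hr : r ^ 2 + D = y ^ 3 * m) (hA : A = r * B + y * t) :
    ∃ k, A ^ 2 + D * B ^ 2 = k * y :=
  ⟨B ^ 2 * y ^ 2 * m + 2 * r * B * t + y * t ^ 2, by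
    rw [hA]; linear_combination B ^ 2 * hr⟩

theorem tm_case_one (x w y : ℤ) (hy : 0 < y) (h : x ^ 2 + w ^ 2 = y ^ 3)
    (hc : IsCoprime w y) (a b : ℕ) (hw : w = 5 ^ (a + 1) * 11 ^ b) (h5 : ¬ (5 : ℤ) ∣ x) :
    False := by
  have h' : x ^ 2 + 1 * w ^ 2 = y ^ 3 := by linarith
  obtain ⟨r, q, m, hx, hr⟩ := tm_root 1 x w y h' hc
  obtain ⟨n, rfl⟩ : ∃ n : ℕ, y = n := ⟨y.toNat, by omega⟩
  have hn : 0 < Nat.sqrt n := Nat.sqrt_pos.mpr (by omega)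
  obtain ⟨A, B, t, hB, hBn, hA, hA2⟩ := tm_dirichlet r n hy _ hn
  obtain ⟨k, hk⟩ := tm_lattice 1 r n m A B t hr hA
  have s1 : (Nat.sqrt n : ℤ) ^ 2 ≤ n := by exact_mod_cast Nat.sqrt_le' n
  have s2 : (n : ℤ) < ((Nat.sqrt n : ℤ) + 1) ^ 2 := by exact_mod_cast Nat.lt_succ_sqrt' n
  have b1 : B ^ 2 ≤ n := by nlinarith
  have b2 : A ^ 2 < n := by nlinarith [sq_nonneg A]
  have k0 : 0 < k := by
    by_contra hcon
    nlinarith [sq_nonneg A]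
  have k2 : k < 2 := by
    by_contra hcon
    nlinarith
  obtain rfl : k = 1 := by omega
  obtain ⟨x3, w3, e, ew, ex⟩ := tm_cube_s6 1 x w n r q m A B t 1 hy h' hx hr hA hk
  -- reduce to a single shape
  have key : ∀ u v s : ℤ, (s = 1 ∨ s = -1) → w = s * (v * (3 * u ^ 2 - v ^ 2)) →
      (5 ∣ u → 5 ∣ v → (5 : ℤ) ∣ x) → False := by
    intro u v s hs hwv hd
    have hdvd : 3 * u ^ 2 - v ^ 2 ∣ 5 ^ (a + 1) * 11 ^ b := by
      rw [← hw, hwv]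
      exact ⟨s * v, by ring⟩
    have h5w : (5 : ℤ) ∣ w := by
      rw [hw, pow_succ]
      exact ⟨5 ^ a * 11 ^ b, by ring⟩
    have hp : Prime (5 : ℤ) := by norm_num
    have hM : ¬ (5 : ℤ) ∣ 3 * u ^ 2 - v ^ 2 := by
      intro hcon
      have hu : u % 5 = 0 ∨ u % 5 = 1 ∨ u % 5 = 2 ∨ u % 5 = 3 ∨ u % 5 = 4 := by omega
      have hv : v % 5 = 0 ∨ v % 5 = 1 ∨ v % 5 = 2 ∨ v % 5 = 3 ∨ v % 5 = 4 := by omega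
      have : u % 5 = 0 ∧ v % 5 = 0 := by
        have := Int.emod_eq_zero_of_dvd hcon
        rcases hu with hu | hu | hu | hu | hu <;> rcases hv with hv | hv | hv | hv | hv <;>
          simp [pow_two, Int.sub_emod, Int.mul_emod, hu, hv] at this ⊢
      exact h5 (hd (Int.dvd_of_emod_eq_zero this.1) (Int.dvd_of_emod_eq_zero this.2))
    have hv5 : (5 : ℤ) ∣ v := by
      rw [hwv] at h5w
      rcases hp.dvd_or_dvd h5w with h1 | h1
      · rcases hs with rfl | rfl <;> norm_num at h1
      · exact (hp.dvd_or_dvd h1).resolve_right hM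
    have hmod := tm_div_mod _ _ _ hdvd hM
    have hu : u % 5 = 0 ∨ u % 5 = 1 ∨ u % 5 = 2 ∨ u % 5 = 3 ∨ u % 5 = 4 := by omega
    have hv := Int.emod_eq_zero_of_dvd hv5
    rcases hu with hu | hu | hu | hu | hu <;>
      simp [pow_two, Int.sub_emod, Int.mul_emod, hu, hv] at hmod
  have hx3 : x3 = 0 ∨ x3 = 1 ∨ x3 = -1 := by
    have : x3 ≤ 1 := by nlinarith [sq_nonneg w3]
    have : -1 ≤ x3 := by nlinarith [sq_nonneg w3]
    omega
  have hd : 5 ∣ A → 5 ∣ B → (5 : ℤ) ∣ x := by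
    rintro ⟨A', rfl⟩ ⟨B', rfl⟩
    have : x = 5 * (x3 * (25 * A' ^ 3 - 75 * A' * B' ^ 2) -
      w3 * (75 * A' ^ 2 * B' - 25 * B' ^ 3)) := by linear_combination ex
    exact ⟨_, this⟩
  rcases hx3 with h0 | h0
  · subst h0
    have hw3 : w3 = 1 ∨ w3 = -1 := by
      have : (w3 - 1) * (w3 + 1) = 0 := by linear_combination e
      rcases mul_eq_zero.mp this with h1 | h1 <;> omega
    refine key B A (-w3) (by omega) (by linear_combination ew) (fun p q => hd q p)
  · have hw3 : w3 = 0 := by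
      have : w3 ^ 2 = 0 := by rcases h0 with rfl | rfl <;> linarith
      exact pow_eq_zero_iff (two_ne_zero) |>.mp this
    subst hw3
    exact key A B x3 h0 (by linear_combination ew) hd

theorem tm_norm (k x3 w3 : ℤ) (k0 : 0 < k) (k2 : k < 5) (e : x3 ^ 2 + 5 * w3 ^ 2 = k ^ 3) :
    (k = 1 ∧ w3 = 0) ∨ (k = 4 ∧ w3 = 0 ∧ (x3 = 8 ∨ x3 = -8)) := by
  have hk : k = 1 ∨ k = 2 ∨ k = 3 ∨ k = 4 := by omega
  have h64 : k ^ 3 ≤ 64 := by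
    rcases hk with rfl | rfl | rfl | rfl <;> norm_num
  have p1 : w3 ≤ 3 := by nlinarith [sq_nonneg x3]
  have p2 : -3 ≤ w3 := by nlinarith [sq_nonneg x3]
  have p3 : x3 ≤ 8 := by nlinarith [sq_nonneg w3]
  have p4 : -8 ≤ x3 := by nlinarith [sq_nonneg w3]
  have hw : w3 ^ 2 = 0 ∧ w3 = 0 ∨ w3 ^ 2 = 1 ∨ w3 ^ 2 = 4 ∨ w3 ^ 2 = 9 := by
    clear e
    interval_cases w3 <;> simp
  have hx : x3 ^ 2 = 0 ∨ x3 ^ 2 = 1 ∨ x3 ^ 2 = 4 ∨ x3 ^ 2 = 9 ∨ x3 ^ 2 = 16 ∨ x3 ^ 2 = 25 ∨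
      x3 ^ 2 = 36 ∨ x3 ^ 2 = 49 ∨ (x3 ^ 2 = 64 ∧ (x3 = 8 ∨ x3 = -8)) := by
    clear e
    interval_cases x3 <;> simp
  generalize x3 ^ 2 = x2 at *
  generalize w3 ^ 2 = w2 at *
  rcases hk with rfl | rfl | rfl | rfl <;> norm_num at e <;> omega

set_option maxHeartbeats 1000000 in
theorem tm_case_five (x w y : ℤ) (hy : 2 < y) (h : x ^ 2 + 5 * w ^ 2 = y ^ 3)
    (hc : IsCoprime w y) (a b : ℕ) (hw : w = 5 ^ a * 11 ^ b) (h5 : ¬ (5 : ℤ) ∣ x) :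
    False := by
  obtain ⟨r, q, m, hx, hr⟩ := tm_root 5 x w y h hc
  obtain ⟨n, rfl⟩ : ∃ n : ℕ, y = n := ⟨y.toNat, by omega⟩
  have hn : 0 < Nat.sqrt (2 * n / 5) := Nat.sqrt_pos.mpr (by omega)
  obtain ⟨A, B, t, hB, hBn, hA, hA2⟩ := tm_dirichlet r n (by omega) _ hn
  obtain ⟨k, hk⟩ := tm_lattice 5 r n m A B t hr hA
  have s1 : (Nat.sqrt (2 * n / 5) : ℤ) ^ 2 ≤ ((2 * n / 5 : ℕ) : ℤ) := by
    exact_mod_cast Nat.sqrt_le' _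
  have s2 : ((2 * n / 5 : ℕ) : ℤ) < ((Nat.sqrt (2 * n / 5) : ℤ) + 1) ^ 2 := by
    exact_mod_cast Nat.lt_succ_sqrt' _
  generalize (Nat.sqrt (2 * n / 5) : ℤ) = S at *
  have s3 : 5 * S ^ 2 ≤ 2 * n := by omega
  have s4 : 2 * (n : ℤ) < 5 * (S + 1) ^ 2 := by omega
  have b1 : 5 * B ^ 2 ≤ 2 * n := by nlinarith
  have b2 : 2 * A ^ 2 ≤ 5 * n := by
    by_contra hcon
    nlinarith [sq_nonneg A]
  have k0 : 0 < k := by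
    by_contra hcon
    nlinarith [sq_nonneg A]
  have k2 : k < 5 := by
    by_contra hcon
    nlinarith
  obtain ⟨x3, w3, e, ew, ex⟩ := tm_cube_s6 5 x w n r q m A B t k (by omega) h hx hr hA hk
  have key : ∀ u v s : ℤ, w = s * (v * (3 * u ^ 2 - 5 * v ^ 2)) →
      x = s * (u * (u ^ 2 - 15 * v ^ 2)) → False := by
    intro u v s hwv hxv
    have hdvd : 3 * u ^ 2 - 5 * v ^ 2 ∣ 5 ^ a * 11 ^ b := by
      rw [← hw, hwv]
      exact ⟨s * v, by ring⟩
    have hu0 : ¬ (5 : ℤ) ∣ u := by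
      rintro ⟨u', rfl⟩
      exact h5 ⟨s * (u' * ((5 * u') ^ 2 - 15 * v ^ 2)), by rw [hxv]; ring⟩
    have hu : u % 5 = 1 ∨ u % 5 = 2 ∨ u % 5 = 3 ∨ u % 5 = 4 := by omega
    have hM : (3 * u ^ 2 - 5 * v ^ 2) % 5 = 2 ∨ (3 * u ^ 2 - 5 * v ^ 2) % 5 = 3 := by
      rcases hu with hu | hu | hu | hu <;>
        simp [pow_two, Int.sub_emod, Int.mul_emod, hu]
    have hmod := tm_div_mod _ _ _ hdvd (by omega)
    omega
  have hz := tm_norm k x3 w3 k0 k2 e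
  rcases hz with ⟨rfl, rfl⟩ | ⟨rfl, rfl, hx3⟩
  · exact key A B x3 (by linear_combination ew) (by linear_combination ex)
  · have hev : A % 2 = 0 ∧ B % 2 = 0 := by
      have hA4 : A % 4 = 0 ∨ A % 4 = 1 ∨ A % 4 = 2 ∨ A % 4 = 3 := by omega
      have hB4 : B % 4 = 0 ∨ B % 4 = 1 ∨ B % 4 = 2 ∨ B % 4 = 3 := by omega
      have h4 : (A ^ 2 + 5 * B ^ 2) % 4 = 0 := by omega
      rcases hA4 with hu | hu | hu | hu <;> rcases hB4 with hv | hv | hv | hv <;>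
        simp [pow_two, Int.add_emod, Int.mul_emod, hu, hv] at h4 <;> omega
    obtain ⟨u, rfl⟩ := Int.dvd_of_emod_eq_zero hev.1
    obtain ⟨v, rfl⟩ := Int.dvd_of_emod_eq_zero hev.2
    rcases hx3 with rfl | rfl
    · exact key u v 1 (by linarith) (by linarith)
    · exact key u v (-1) (by linarith) (by linarith)

set_option maxHeartbeats 4000000 in
theorem thue_mahler_quartic_no_solution (X Y : ℤ) (hcop : Int.gcd X (2 * 13 * Y) = 1)
    (c d : ℕ) :
    150975 * X ^ 4 + 185900 * X ^ 3 * Y + 85800 * X ^ 2 * Y ^ 2 + 17592 * X * Y ^ 3 +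
      1352 * Y ^ 4 ≠ 5 ^ c * 11 ^ d := by
  intro hF
  have hcop' : IsCoprime X (2 * 13 * Y) := Int.isCoprime_iff_gcd_eq_one.mpr hcop
  have hXY : IsCoprime X Y := hcop'.of_mul_right_right
  have hX2 : IsCoprime X 2 := hcop'.of_mul_right_left.of_mul_right_left
  have hXodd : X % 2 = 1 := by
    have : ¬ (2 : ℤ) ∣ X := (Int.prime_two.coprime_iff_not_dvd).mp hX2.symm
    omega
  -- `d` is odd
  have p5 : (5 : ℤ) ^ c % 4 = 1 := by
    have : (5 : ℤ) ^ c ≡ 1 ^ c [ZMOD 4] := Int.ModEq.pow c (by decide)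
    rw [one_pow] at this
    exact this
  have hX4 : X ^ 4 % 4 = 1 := by
    have : X % 4 = 1 ∨ X % 4 = 3 := by omega
    rcases this with hh | hh <;> simp [pow_succ, Int.mul_emod, hh]
  have hF4 : (5 ^ c * 11 ^ d : ℤ) % 4 = 3 := by
    rw [← hF]
    generalize X ^ 4 = X4 at *
    have e : 150975 * X4 + 185900 * X ^ 3 * Y + 85800 * X ^ 2 * Y ^ 2 + 17592 * X * Y ^ 3 +
      1352 * Y ^ 4 = 150975 * X4 + 4 * (46475 * X ^ 3 * Y + 21450 * X ^ 2 * Y ^ 2 +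
        4398 * X * Y ^ 3 + 338 * Y ^ 4) := by ring
    rw [e]
    omega
  have hd : Odd d := by
    by_contra hcon
    rw [Nat.not_odd_iff_even] at hcon
    obtain ⟨d', rfl⟩ := hcon
    have q : (11 : ℤ) ^ (d' + d') % 4 = 1 := by
      rw [← two_mul, pow_mul]
      have : ((11 : ℤ) ^ 2) ^ d' ≡ 1 ^ d' [ZMOD 4] := Int.ModEq.pow d' (by decide)
      rw [one_pow] at this
      exact this
    rw [Int.mul_emod, p5, q] at hF4
    norm_num at hF4
  obtain ⟨d', rfl⟩ := hd
  have p11 : ∀ j : ℕ, (11 : ℤ) ^ j % 5 = 1 := by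
    intro j
    have : (11 : ℤ) ^ j ≡ 1 ^ j [ZMOD 5] := Int.ModEq.pow j (by decide)
    rw [one_pow] at this
    exact this
  have pr5 : Prime (5 : ℤ) := by norm_num
  have pr11 : Prime (11 : ℤ) := by norm_num
  -- `5 ∤ Y`
  have hY5 : ¬ (5 : ℤ) ∣ Y := by
    rintro ⟨Z, rfl⟩
    have hX5 : ¬ (5 : ℤ) ∣ X := by
      intro hx
      exact pr5.not_isUnit (hXY.isUnit_of_dvd' hx ⟨Z, rfl⟩)
    have hX45 : X ^ 4 % 5 = 1 := by
      have : X % 5 = 1 ∨ X % 5 = 2 ∨ X % 5 = 3 ∨ X % 5 = 4 := by omega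
      rcases this with hh | hh | hh | hh <;> simp [pow_succ, Int.mul_emod, hh]
    have e : (5 : ℤ) ^ c * 11 ^ (2 * d' + 1) = 25 * (6039 * X ^ 4 + 5 * (7436 * X ^ 3 * Z +
        17160 * X ^ 2 * Z ^ 2 + 17592 * X * Z ^ 3 + 6760 * Z ^ 4)) := by
      rw [← hF]; ring
    have q := p11 (2 * d' + 1)
    generalize (7436 * X ^ 3 * Z +
        17160 * X ^ 2 * Z ^ 2 + 17592 * X * Z ^ 3 + 6760 * Z ^ 4) = R at e
    generalize X ^ 4 = X4 at *
    generalize (11 : ℤ) ^ (2 * d' + 1) = T at *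
    match c with
    | 0 => norm_num at e; omega
    | 1 => norm_num at e; omega
    | 2 => norm_num at e; omega
    | c + 3 =>
      have e3 : (5 : ℤ) ^ (c + 3) * T = 125 * (5 ^ c * T) := by ring
      rw [e3] at e
      generalize (5 : ℤ) ^ c * T = W at e
      omega
  -- `11 ∤ Y`
  have hY11 : ¬ (11 : ℤ) ∣ Y := by
    rintro ⟨Z, rfl⟩
    have hX11 : ¬ (11 : ℤ) ∣ X := by
      intro hx
      exact pr11.not_isUnit (hXY.isUnit_of_dvd' hx ⟨Z, rfl⟩)
    have hX411 : X ^ 4 % 11 = 1 ∨ X ^ 4 % 11 = 3 ∨ X ^ 4 % 11 = 4 ∨ X ^ 4 % 11 = 5 ∨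
        X ^ 4 % 11 = 9 := by
      have : X % 11 = 1 ∨ X % 11 = 2 ∨ X % 11 = 3 ∨ X % 11 = 4 ∨ X % 11 = 5 ∨ X % 11 = 6 ∨
        X % 11 = 7 ∨ X % 11 = 8 ∨ X % 11 = 9 ∨ X % 11 = 10 := by omega
      rcases this with hh | hh | hh | hh | hh | hh | hh | hh | hh | hh <;>
        simp [pow_succ, Int.mul_emod, hh]
    have h5c : (5 : ℤ) ^ c % 11 = 1 ∨ (5 : ℤ) ^ c % 11 = 3 ∨ (5 : ℤ) ^ c % 11 = 4 ∨
        (5 : ℤ) ^ c % 11 = 5 ∨ (5 : ℤ) ^ c % 11 = 9 := by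
      clear hF hF4 p5
      induction c with
      | zero => simp
      | succ c ih => rw [pow_succ]; omega
    have e : (5 : ℤ) ^ c * 11 ^ (2 * d' + 1) = 11 * (13725 * X ^ 4 + 11 * (16900 * X ^ 3 * Z +
        85800 * X ^ 2 * Z ^ 2 + 193512 * X * Z ^ 3 + 163592 * Z ^ 4)) := by
      rw [← hF]; ring
    generalize (16900 * X ^ 3 * Z +
        85800 * X ^ 2 * Z ^ 2 + 193512 * X * Z ^ 3 + 163592 * Z ^ 4) = R at e
    generalize X ^ 4 = X4 at *
    match d' with
    | 0 =>
      norm_num at e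
      generalize (5 : ℤ) ^ c = T at *
      omega
    | j + 1 =>
      have e3 : (5 : ℤ) ^ c * 11 ^ (2 * (j + 1) + 1) = 121 * (5 ^ c * 11 ^ (2 * j + 1)) := by ring
      rw [e3] at e
      generalize (5 : ℤ) ^ c * 11 ^ (2 * j + 1) = W at e
      omega
  -- the covariants
  obtain ⟨y, hy⟩ : ∃ y, y = 983125 * X ^ 4 + 1208900 * X ^ 3 * Y + 557700 * X ^ 2 * Y ^ 2 +
    114400 * X * Y ^ 3 + 8804 * Y ^ 4 := ⟨_, rfl⟩
  obtain ⟨x, hx⟩ : ∃ x, x = 62315000 * X ^ 6 + 76683750 * X ^ 5 * Y + 29493750 * X ^ 4 * Y ^ 2 +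
    5500 * X ^ 3 * Y ^ 3 - 2788500 * X ^ 2 * Y ^ 4 - 686400 * X * Y ^ 5 - 52792 * Y ^ 6 :=
    ⟨_, rfl⟩
  have hxy : x ^ 2 + 275 * (5 ^ c * 11 ^ (2 * d' + 1)) ^ 3 = y ^ 3 := by
    rw [← hF, hx, hy]; ring
  have hy5 : ¬ (5 : ℤ) ∣ y := by
    intro hcon
    have h1 : (5 : ℤ) ∣ Y ^ 4 := by
      have e : y = 5 * (196625 * X ^ 4 + 241780 * X ^ 3 * Y + 111540 * X ^ 2 * Y ^ 2 +
        22880 * X * Y ^ 3 + 1760 * Y ^ 4) + 4 * Y ^ 4 := by rw [hy]; ring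
      clear hxy hF hF4 hx hy
      generalize 196625 * X ^ 4 + 241780 * X ^ 3 * Y + 111540 * X ^ 2 * Y ^ 2 +
        22880 * X * Y ^ 3 + 1760 * Y ^ 4 = R at e
      generalize Y ^ 4 = Y4 at *
      omega
    exact hY5 (pr5.dvd_of_dvd_pow h1)
  have hy11 : ¬ (11 : ℤ) ∣ y := by
    intro hcon
    have h1 : (11 : ℤ) ∣ Y ^ 4 := by
      have e : y = 11 * (89375 * X ^ 4 + 109900 * X ^ 3 * Y + 50700 * X ^ 2 * Y ^ 2 +
        10400 * X * Y ^ 3 + 800 * Y ^ 4) + 4 * Y ^ 4 := by rw [hy]; ring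
      clear hxy hF hF4 hx hy
      generalize 89375 * X ^ 4 + 109900 * X ^ 3 * Y + 50700 * X ^ 2 * Y ^ 2 +
        10400 * X * Y ^ 3 + 800 * Y ^ 4 = R at e
      generalize Y ^ 4 = Y4 at *
      omega
    exact hY11 (pr11.dvd_of_dvd_pow h1)
  have hx5 : ¬ (5 : ℤ) ∣ x := by
    intro hcon
    have h1 : (5 : ℤ) ∣ y ^ 3 := by
      rw [← hxy]
      exact dvd_add (dvd_pow hcon two_ne_zero) (Dvd.dvd.mul_right (by norm_num) _)
    exact hy5 (pr5.dvd_of_dvd_pow h1)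
  have hypos : 2 < y := by
    by_contra hcon
    have h1 : (1 : ℤ) ≤ 5 ^ c * 11 ^ (2 * d' + 1) := by
      have : (0 : ℤ) < 5 ^ c * 11 ^ (2 * d' + 1) := by positivity
      omega
    have h2 : (1 : ℤ) ≤ (5 ^ c * 11 ^ (2 * d' + 1)) ^ 3 := one_le_pow₀ h1
    have h3 : y ^ 3 ≤ 8 := by
      have : y ≤ 2 := by omega
      nlinarith [sq_nonneg (y + 1), sq_nonneg y]
    nlinarith [sq_nonneg x]
  have hcw : ∀ a b : ℕ, IsCoprime ((5 : ℤ) ^ a * 11 ^ b) y := fun a b =>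
    IsCoprime.mul_left ((pr5.coprime_iff_not_dvd.mpr hy5).pow_left)
      ((pr11.coprime_iff_not_dvd.mpr hy11).pow_left)
  rcases Nat.even_or_odd' c with ⟨c', rfl | rfl⟩
  · refine tm_case_one x (5 ^ (3 * c' + 1) * 11 ^ (3 * d' + 2)) y (by omega) ?_ (hcw _ _) (3 * c')
      (3 * d' + 2) rfl hx5
    rw [← hxy]
    ring
  · refine tm_case_five x (5 ^ (3 * c' + 2) * 11 ^ (3 * d' + 2)) y hypos ?_ (hcw _ _) _ _ rfl hx5
    rw [← hxy]
    ring
end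

section
/- The only integer solution of the Thue equation X³ + 275·Y³ = 1 is (X,Y) = (1,0); consequently the only integer solution of X³ + 275·Y³ = −1 is (X,Y) = (−1,0). -/
theorem thue_aux_cube25 : ∀ x : ZMod 25, x ^ 3 = 1 → x = 1 := by decide

theorem thue_aux_cube11 : ∀ x : ZMod 11, x ^ 3 = 1 → x = 1 := by decide

theorem thue_aux_nine : ∀ a c : ZMod 9,
    (1 + 275 * a ^ 3) ^ 2 + (1 + 275 * a ^ 3) + 1 = c ^ 3 → a ^ 3 = 0 := by decide

/-- A solution has `X` congruent to 1 modulo 275. -/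
theorem thue_aux_dvd (X Y : ℤ) (h : X ^ 3 + 275 * Y ^ 3 = 1) : ∃ k, X = 1 + 275 * k := by
  have h25 : (25 : ℤ) ∣ X - 1 := by
    have h1 := congrArg (Int.cast : ℤ → ZMod 25) h
    push_cast at h1
    have h0 : (275 : ZMod 25) = 0 := by decide
    rw [h0, zero_mul, add_zero] at h1
    have h2 := thue_aux_cube25 _ h1
    exact (ZMod.intCast_zmod_eq_zero_iff_dvd (X - 1) 25).1 (by push_cast; rw [h2, sub_self])
  have h11 : (11 : ℤ) ∣ X - 1 := by
    have h1 := congrArg (Int.cast : ℤ → ZMod 11) h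
    push_cast at h1
    have h0 : (275 : ZMod 11) = 0 := by decide
    rw [h0, zero_mul, add_zero] at h1
    have h2 := thue_aux_cube11 _ h1
    exact (ZMod.intCast_zmod_eq_zero_iff_dvd (X - 1) 11).1 (by push_cast; rw [h2, sub_self])
  exact ⟨(X - 1) / 275, by omega⟩

/-- Consecutive cubes never differ by a cube, except trivially (Fermat for exponent 3). -/
theorem thue_aux_flt (n y : ℤ) (h : 3 * n ^ 2 + 3 * n + 1 = y ^ 3) : n = 0 ∨ n = -1 := by
  by_contra! hn
  have hy : y ≠ 0 := by
    rintro rfl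
    have : 3 * (n ^ 2 + n) = -1 := by linarith
    omega
  have hF := (fermatLastTheoremFor_iff_int.1 fermatLastTheoremThree)
  exact hF n y (n + 1) hn.1 hy (by intro h0; exact hn.2 (by omega)) (by rw [← h]; ring)

theorem thue_aux_main (X Y : ℤ) (h : X ^ 3 + 275 * Y ^ 3 = 1) : X = 1 := by
  obtain ⟨k, rfl⟩ := thue_aux_dvd X Y h
  have hprod : k * ((1 + 275 * k) ^ 2 + (1 + 275 * k) + 1) = (-Y) ^ 3 := by
    linarith [show 275 * (k * ((1 + 275 * k) ^ 2 + (1 + 275 * k) + 1)) = 275 * (-Y) ^ 3 by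
      linear_combination h]
  by_cases h3 : (3 : ℤ) ∣ k
  · obtain ⟨j, rfl⟩ := h3
    have hY : (3 : ℤ) ∣ Y := by
      have : (3 : ℤ) ∣ (-Y) ^ 3 := by
        rw [← hprod]; exact Dvd.dvd.mul_right (dvd_mul_right 3 j) _
      exact (dvd_neg).1 (Int.prime_three.dvd_of_dvd_pow this)
    obtain ⟨Z, rfl⟩ := hY
    have hp2 : j * (3 * (275 * j) ^ 2 + 3 * (275 * j) + 1) = 3 * (-Z) ^ 3 := by
      linarith [show 9 * (j * (3 * (275 * j) ^ 2 + 3 * (275 * j) + 1)) = 9 * (3 * (-Z) ^ 3) by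
        linear_combination hprod]
    obtain ⟨i, rfl⟩ : (3 : ℤ) ∣ j :=
      ⟨(-Z) ^ 3 - j * ((275 * j) ^ 2 + 275 * j), by linear_combination hp2⟩
    have hp3 : i * (3 * (825 * i) ^ 2 + 3 * (825 * i) + 1) = (-Z) ^ 3 := by
      linarith [show 3 * (i * (3 * (825 * i) ^ 2 + 3 * (825 * i) + 1)) = 3 * (-Z) ^ 3 by
        linear_combination hp2]
    have hco : IsCoprime i (3 * (825 * i) ^ 2 + 3 * (825 * i) + 1) :=
      ⟨-(3 * 825 ^ 2 * i + 3 * 825), 1, by ring⟩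
    obtain ⟨y, hy⟩ := Int.eq_pow_of_mul_eq_pow_odd_right hco (by decide : Odd 3) hp3
    rcases thue_aux_flt _ _ hy with h0 | h0 <;> omega
  · exfalso
    have hco : IsCoprime k ((1 + 275 * k) ^ 2 + (1 + 275 * k) + 1) := by
      have : k % 3 = 1 ∨ k % 3 = 2 := by omega
      rcases this with hk | hk
      · obtain ⟨j, rfl⟩ : ∃ j, k = 3 * j + 1 := ⟨k / 3, by omega⟩
        exact ⟨1 + j * 275 * (3 + 275 * (3 * j + 1)), -j, by ring⟩
      · obtain ⟨j, rfl⟩ : ∃ j, k = 3 * j - 1 := ⟨k / 3 + 1, by omega⟩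
        exact ⟨-1 - j * 275 * (3 + 275 * (3 * j - 1)), j, by ring⟩
    obtain ⟨⟨a, ha⟩, c, hc⟩ := Int.eq_pow_of_mul_eq_pow_odd hco (by decide : Odd 3) hprod
    rw [ha] at hc
    have h1 := congrArg (Int.cast : ℤ → ZMod 9) hc
    push_cast at h1
    have h2 := thue_aux_nine _ _ h1
    have h9 : (9 : ℤ) ∣ a ^ 3 :=
      (ZMod.intCast_zmod_eq_zero_iff_dvd (a ^ 3) 9).1 (by push_cast; exact h2)
    rw [← ha] at h9
    omega

theorem thue_aux_pos (X Y : ℤ) (h : X ^ 3 + 275 * Y ^ 3 = 1) : X = 1 ∧ Y = 0 := by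
  have hX := thue_aux_main X Y h
  subst hX
  refine ⟨rfl, ?_⟩
  have : Y ^ 3 = 0 := by linarith
  exact pow_eq_zero_iff (by norm_num) |>.1 this

theorem thue_cubic_275 :
    (∀ X Y : ℤ, X ^ 3 + 275 * Y ^ 3 = 1 → X = 1 ∧ Y = 0) ∧
    (∀ X Y : ℤ, X ^ 3 + 275 * Y ^ 3 = -1 → X = -1 ∧ Y = 0) := by
  refine ⟨thue_aux_pos, fun X Y h => ?_⟩
  have := thue_aux_pos (-X) (-Y) (by linear_combination -h)
  omega
end

section
/- There are no integers v₁, v₂, s with s ∈ {−1, 1} and gcd(2v₁, v₂) = 1, and odd positive integers c, d, such that 275·v₂⁴ + 8s·v₁³·v₂ = −5^c·11^d, i.e. such that v₂·((2s·v₁)³ + 275·v₂³) = −5^c·11^d. -/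
lemma aux_cube (u N : ℤ) (c d : ℕ) (hN : N = 5 ^ c * 11 ^ d) (h : u ^ 3 = 1 + 275 * N ^ 3) : False := by
  have hNpos : 0 < N := by rw [hN]; positivity
  have p5 : Prime (5 : ℤ) := by norm_num
  have p11 : Prime (11 : ℤ) := by norm_num
  have h5 : ¬ (5 : ℤ) ∣ u ^ 2 + u + 1 := by
    intro hd
    have h0 := Int.emod_eq_zero_of_dvd hd
    have : u % 5 = 0 ∨ u % 5 = 1 ∨ u % 5 = 2 ∨ u % 5 = 3 ∨ u % 5 = 4 := by omega
    rcases this with h | h | h | h | h <;> simp [pow_two, Int.add_emod, Int.mul_emod, h] at h0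
  have h11 : ¬ (11 : ℤ) ∣ u ^ 2 + u + 1 := by
    intro hd
    have h0 := Int.emod_eq_zero_of_dvd hd
    have : u % 11 = 0 ∨ u % 11 = 1 ∨ u % 11 = 2 ∨ u % 11 = 3 ∨ u % 11 = 4 ∨ u % 11 = 5 ∨
      u % 11 = 6 ∨ u % 11 = 7 ∨ u % 11 = 8 ∨ u % 11 = 9 ∨ u % 11 = 10 := by omega
    rcases this with h | h | h | h | h | h | h | h | h | h | h <;>
      simp [pow_two, Int.add_emod, Int.mul_emod, h] at h0
  have c5 : IsCoprime (u ^ 2 + u + 1) 5 := ((Prime.coprime_iff_not_dvd p5).2 h5).symm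
  have c11 : IsCoprime (u ^ 2 + u + 1) 11 := ((Prime.coprime_iff_not_dvd p11).2 h11).symm
  have cN : IsCoprime (u ^ 2 + u + 1) N := by
    rw [hN]; exact (c5.pow_right).mul_right c11.pow_right
  have cA : IsCoprime (u ^ 2 + u + 1) (5 ^ 2 * 11 * N ^ 3) :=
    ((c5.pow_right).mul_right c11).mul_right cN.pow_right
  have hdv : u ^ 2 + u + 1 ∣ 5 ^ 2 * 11 * N ^ 3 := ⟨u - 1, by linarith⟩
  have hu := cA.isUnit_of_dvd' dvd_rfl hdv
  have hN3 : 0 < N ^ 3 := by positivity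
  have hu1 : 1 < u := by
    by_contra hle
    have : u ^ 3 ≤ 1 := by nlinarith [sq_nonneg (u + 1), sq_nonneg u]
    linarith
  rcases Int.isUnit_iff.1 hu with h1 | h1 <;> nlinarith

theorem no_v1_v2_solution (v₁ v₂ s : ℤ) (hs : s = -1 ∨ s = 1)
    (hcop : Int.gcd (2 * v₁) v₂ = 1) (c d : ℕ) (hc : Odd c) (hd : Odd d)
    (hc0 : 0 < c) (hd0 : 0 < d) :
    275 * v₂ ^ 4 + 8 * s * v₁ ^ 3 * v₂ ≠ -(5 ^ c * 11 ^ d) := by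
  intro heq
  have p5 : Prime (5 : ℤ) := by norm_num
  have p11 : Prime (11 : ℤ) := by norm_num
  obtain ⟨w, hw, hcw⟩ : ∃ w : ℤ, w = 2 * (s * v₁) ∧ IsCoprime w v₂ := by
    refine ⟨_, rfl, ?_⟩
    have h := Int.isCoprime_iff_gcd_eq_one.2 hcop
    rcases hs with rfl | rfl
    · have := h.neg_left
      have e : 2 * (-1 * v₁) = -(2 * v₁) := by ring
      rw [e]; exact this
    · simpa using h
  have hE : v₂ * (w ^ 3 + 275 * v₂ ^ 3) = -(5 ^ c * 11 ^ d) := by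
    rw [← heq, hw]
    rcases hs with rfl | rfl <;> ring
  have hcases : ∀ p : ℤ, Prime p → p ∣ v₂ → ¬ p ∣ w := fun p hp h1 h2 =>
    hp.not_isUnit (hcw.isUnit_of_dvd' h2 h1)
  have hnT : ∀ p : ℤ, Prime p → p ∣ v₂ → IsCoprime p (w ^ 3 + 275 * v₂ ^ 3) := by
    intro p hp h1
    refine (Prime.coprime_iff_not_dvd hp).2 fun h2 => hcases p hp h1 ?_
    refine hp.dvd_of_dvd_pow (n := 3) ?_
    exact (dvd_add_left ((dvd_pow h1 (by norm_num)).mul_left _)).1 h2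
  have h5 : (5 : ℤ) ∣ v₂ := by
    by_contra hn
    have hdT : (5 : ℤ) ∣ w ^ 3 + 275 * v₂ ^ 3 := by
      have : (5 : ℤ) ∣ v₂ * (w ^ 3 + 275 * v₂ ^ 3) := by
        rw [hE]
        exact ((dvd_pow_self _ hc0.ne').mul_right _).neg_right
      exact (p5.dvd_or_dvd this).resolve_left hn
    have hdw : (5 : ℤ) ∣ w := p5.dvd_of_dvd_pow (n := 3) (by omega)
    obtain ⟨k, rfl⟩ := hdw
    obtain ⟨j, rfl⟩ := hc
    rcases Nat.eq_zero_or_pos j with rfl | hj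
    · have : (5 : ℤ) ∣ 11 ^ d := ⟨-(v₂ * (5 * k ^ 3 + 11 * v₂ ^ 3)), by
        simp only [mul_zero, zero_add, pow_one] at hE
        linarith⟩
      have := p5.dvd_of_dvd_pow this
      omega
    · obtain ⟨i, rfl⟩ : ∃ i, j = i + 1 := ⟨j - 1, by omega⟩
      have : (5 : ℤ) ∣ 11 * v₂ ^ 4 := ⟨-(5 ^ (2 * i) * 11 ^ d) - v₂ * k ^ 3, by
        have e : (5 : ℤ) ^ (2 * (i + 1) + 1) = 125 * 5 ^ (2 * i) := by ring
        rw [e] at hE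
        linarith⟩
      rcases p5.dvd_or_dvd this with h | h
      · omega
      · exact hn (p5.dvd_of_dvd_pow h)
  have h5c : (5 : ℤ) ^ c ∣ v₂ := by
    refine ((hnT 5 p5 h5).pow_left (m := c)).dvd_of_dvd_mul_right ?_
    rw [hE]; exact (dvd_mul_right _ _).neg_right
  by_cases h11 : (11 : ℤ) ∣ v₂
  · have h11d : (11 : ℤ) ^ d ∣ v₂ := by
      refine ((hnT 11 p11 h11).pow_left (m := d)).dvd_of_dvd_mul_right ?_
      rw [hE]; exact (dvd_mul_left _ _).neg_right
    have hco : IsCoprime ((5 : ℤ) ^ c) (11 ^ d) :=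
      IsCoprime.pow ((Prime.coprime_iff_not_dvd p5).2 (by omega))
    obtain ⟨m, hm⟩ := hco.mul_dvd h5c h11d
    obtain ⟨N, hN⟩ : ∃ N : ℤ, N = 5 ^ c * 11 ^ d := ⟨_, rfl⟩
    have hN0 : N ≠ 0 := by rw [hN]; positivity
    rw [← hN] at hm hE
    have hmT : m * (w ^ 3 + 275 * v₂ ^ 3) = -1 := by
      apply mul_left_cancel₀ hN0
      rw [← mul_assoc, ← hm, hE]; ring
    have hmu : IsUnit m := IsUnit.of_mul_eq_one (-(w ^ 3 + 275 * v₂ ^ 3)) (by linarith)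
    rcases Int.isUnit_iff.1 hmu with rfl | rfl
    · refine aux_cube (-w) N c d hN ?_
      rw [hm] at hmT; linarith
    · refine aux_cube w N c d hN ?_
      rw [hm] at hmT; linarith
  · have hdT : (11 : ℤ) ∣ w ^ 3 + 275 * v₂ ^ 3 := by
      have : (11 : ℤ) ∣ v₂ * (w ^ 3 + 275 * v₂ ^ 3) := by
        rw [hE]
        exact ((dvd_pow_self _ hd0.ne').mul_left _).neg_right
      exact (p11.dvd_or_dvd this).resolve_left h11
    have hdw : (11 : ℤ) ∣ w := p11.dvd_of_dvd_pow (n := 3) (by omega)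
    obtain ⟨k, rfl⟩ := hdw
    obtain ⟨e, rfl⟩ : ∃ e, d = e + 1 := ⟨d - 1, by omega⟩
    have hE2 : v₂ * (121 * k ^ 3 + 25 * v₂ ^ 3) = -(5 ^ c * 11 ^ e) := by
      rw [pow_succ (11 : ℤ) e] at hE; linarith
    rcases Nat.eq_zero_or_pos e with rfl | he
    · obtain ⟨m, hm⟩ := h5c
      obtain ⟨N, hN⟩ : ∃ N : ℤ, N = 5 ^ c := ⟨_, rfl⟩
      have hN0 : N ≠ 0 := by rw [hN]; positivity
      rw [← hN] at hm hE2
      have hmT : m * (121 * k ^ 3 + 25 * v₂ ^ 3) = -1 := by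
        apply mul_left_cancel₀ hN0
        rw [← mul_assoc, ← hm, hE2]; ring
      have hmu : IsUnit m := IsUnit.of_mul_eq_one (-(121 * k ^ 3 + 25 * v₂ ^ 3)) (by linarith)
      have hN4 : N ^ 3 % 4 = 1 := by
        have : N ^ 3 ≡ 1 [ZMOD 4] := by
          rw [hN]
          have h : (5 : ℤ) ≡ 1 [ZMOD 4] := by decide
          simpa using (h.pow c).pow 3
        exact this
      obtain ⟨r, rfl⟩ : ∃ r, k = 2 * r := ⟨k / 2, by omega⟩
      have e8 : (2 * r) ^ 3 = 8 * r ^ 3 := by ring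
      rw [hm, e8] at hmT
      rcases Int.isUnit_iff.1 hmu with rfl | rfl
      · rw [mul_one] at hmT; omega
      · have e3 : (N * -1) ^ 3 = - N ^ 3 := by ring
        rw [e3] at hmT; omega
    · obtain ⟨f, rfl⟩ : ∃ f, e = f + 1 := ⟨e - 1, by omega⟩
      have : (11 : ℤ) ∣ 25 * v₂ ^ 4 := ⟨-(5 ^ c * 11 ^ f) - 11 * (v₂ * k ^ 3), by
        rw [pow_succ (11 : ℤ) f] at hE2
        linarith⟩
      rcases p11.dvd_or_dvd this with h | h
      · omega
      · exact h11 (p11.dvd_of_dvd_pow h)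
end

section
/- Let d ∈ {1, 11} and let u, v be integers such that 4 divides u² + d·v² and 5 does not divide u·v·(3u² − d·v²)·(u² − d·v²). Define the integer sequence (L_m) by L₀ = 0, L₁ = 1 and L_m = u·L_{m−1} − ((u² + d·v²)/4)·L_{m−2} for m ≥ 2. Then 5 does not divide L_m for any m ≥ 1; in particular 5 is never a primitive divisor of any term L_n. -/
theorem lucas_seq_not_div_five (d : ℤ) (hd : d = 1 ∨ d = 11) (u v : ℤ)
    (h4 : (4 : ℤ) ∣ u ^ 2 + d * v ^ 2)
    (h5 : ¬ (5 : ℤ) ∣ u * v * (3 * u ^ 2 - d * v ^ 2) * (u ^ 2 - d * v ^ 2))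
    (L : ℕ → ℤ) (hL0 : L 0 = 0) (hL1 : L 1 = 1)
    (hLrec : ∀ m, L (m + 2) = u * L (m + 1) - ((u ^ 2 + d * v ^ 2) / 4) * L m) :
    ∀ m, 1 ≤ m → ¬ (5 : ℤ) ∣ L m := by
  have key : ∀ D a b : ZMod 5, (D = 1 ∨ D = 11) →
      a * b * (3 * a ^ 2 - D * b ^ 2) * (a ^ 2 - D * b ^ 2) ≠ 0 →
      a ≠ 0 ∧ a ^ 2 + D * b ^ 2 = 0 := by decide
  have hcast : ∀ x : ℤ, (5 : ℤ) ∣ x ↔ (x : ZMod 5) = 0 := fun x => by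
    simpa using (ZMod.intCast_zmod_eq_zero_iff_dvd x 5).symm
  obtain ⟨hu, hs⟩ := key (d : ZMod 5) (u : ZMod 5) (v : ZMod 5)
    (by rcases hd with rfl | rfl <;> simp)
    (by rw [hcast] at h5; push_cast at h5; exact h5)
  have hs' : (5 : ℤ) ∣ u ^ 2 + d * v ^ 2 := by
    rw [hcast]; push_cast; exact hs
  -- the second coefficient vanishes modulo 5
  have hQ : (((u ^ 2 + d * v ^ 2) / 4 : ℤ) : ZMod 5) = 0 := by
    rw [← hcast]
    omega
  have hpow : ∀ m, (L (m + 1) : ZMod 5) = (u : ZMod 5) ^ m := by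
    intro m
    induction m with
    | zero => simp [hL1]
    | succ k ih =>
      rw [hLrec k, Int.cast_sub, Int.cast_mul, Int.cast_mul, hQ, ih]
      ring
  haveI : Fact (Nat.Prime 5) := ⟨by norm_num⟩
  intro m hm
  obtain ⟨k, rfl⟩ : ∃ k, m = k + 1 := ⟨m - 1, by omega⟩
  rw [hcast, hpow]
  exact pow_ne_zero _ hu
end

section
/- Let d ∈ {1, 5} and let u₁, v₁ be integers such that 11 does not divide u₁·v₁·(3u₁² − d·v₁²)·(u₁² − d·v₁²) and 11 does not divide u₁² + d·v₁². Define the integer sequence (L_m) by L₀ = 0, L₁ = 1 and L_m = 2u₁·L_{m−1} − (u₁² + d·v₁²)·L_{m−2} for m ≥ 2. Then for every prime n ≥ 5, 11 does not divide L_n; in particular 11 is never a primitive divisor of L_n for prime n ≥ 5. -/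
/-- The Lucas recursion modulo 11, iterated `n` times from the pair `(a, b)`. -/
def lucIter (p q : ZMod 11) : ℕ → ZMod 11 → ZMod 11 → ZMod 11
  | 0, a, _ => a
  | n + 1, a, b => lucIter p q n b (p * b - q * a)

set_option maxRecDepth 100000 in
set_option maxHeartbeats 4000000 in
theorem luc_key : ∀ d : ZMod 11, (d = 1 ∨ d = 5) → ∀ u v : ZMod 11,
    u * v * (3 * u ^ 2 - d * v ^ 2) * (u ^ 2 - d * v ^ 2) ≠ 0 → u ^ 2 + d * v ^ 2 ≠ 0 →
    lucIter (2 * u) (u ^ 2 + d * v ^ 2) 12 0 1 = 0 ∧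
    lucIter (2 * u) (u ^ 2 + d * v ^ 2) 13 0 1 ≠ 0 ∧
    lucIter (2 * u) (u ^ 2 + d * v ^ 2) 1 0 1 ≠ 0 ∧
    lucIter (2 * u) (u ^ 2 + d * v ^ 2) 5 0 1 ≠ 0 ∧
    lucIter (2 * u) (u ^ 2 + d * v ^ 2) 7 0 1 ≠ 0 ∧
    lucIter (2 * u) (u ^ 2 + d * v ^ 2) 11 0 1 ≠ 0 := by
  rintro d (rfl | rfl) <;> decide +kernel

theorem lucIter_eq (p q : ZMod 11) (M : ℕ → ZMod 11)
    (hM : ∀ m, M (m + 2) = p * M (m + 1) - q * M m) (n : ℕ) :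
    ∀ k, lucIter p q n (M k) (M (k + 1)) = M (n + k) := by
  induction n with
  | zero => intro k; simp [lucIter]
  | succ n ih =>
    intro k
    rw [lucIter, ← hM, ih (k + 1)]
    congr 1
    omega

theorem lucas_seq_not_div_eleven (d : ℤ) (hd : d = 1 ∨ d = 5) (u₁ v₁ : ℤ)
    (h11 : ¬ (11 : ℤ) ∣ u₁ * v₁ * (3 * u₁ ^ 2 - d * v₁ ^ 2) * (u₁ ^ 2 - d * v₁ ^ 2))
    (h11' : ¬ (11 : ℤ) ∣ u₁ ^ 2 + d * v₁ ^ 2)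
    (L : ℕ → ℤ) (hL0 : L 0 = 0) (hL1 : L 1 = 1)
    (hLrec : ∀ m, L (m + 2) = 2 * u₁ * L (m + 1) - (u₁ ^ 2 + d * v₁ ^ 2) * L m) :
    ∀ n : ℕ, n.Prime → 5 ≤ n → ¬ (11 : ℤ) ∣ L n := by
  have hz : ∀ x : ℤ, (11 : ℤ) ∣ x ↔ (x : ZMod 11) = 0 := fun x =>
    (ZMod.intCast_zmod_eq_zero_iff_dvd x 11).symm
  rw [hz] at h11 h11'
  push_cast at h11 h11'
  have hd' : (d : ZMod 11) = 1 ∨ (d : ZMod 11) = 5 := by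
    rcases hd with rfl | rfl <;> simp
  obtain ⟨M, hMd⟩ : ∃ M : ℕ → ZMod 11, ∀ m, M m = (L m : ZMod 11) := ⟨_, fun _ => rfl⟩
  have hM : ∀ m, M (m + 2) = (2 * (u₁ : ZMod 11)) * M (m + 1)
      - ((u₁ : ZMod 11) ^ 2 + d * (v₁ : ZMod 11) ^ 2) * M m := by
    intro m
    rw [hMd, hMd, hMd, hLrec]
    push_cast
    ring
  have hM0 : M 0 = 0 := by simp [hMd, hL0]
  have hM1 : M 1 = 1 := by simp [hMd, hL1]
  have key := luc_key d hd' u₁ v₁ h11 h11'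
  have hit : ∀ n, lucIter (2 * (u₁ : ZMod 11)) ((u₁ : ZMod 11) ^ 2 + d * (v₁ : ZMod 11) ^ 2) n 0 1
      = M n := by
    intro n
    have := lucIter_eq _ _ M hM n 0
    simpa [hM0, hM1] using this
  simp only [hit] at key
  obtain ⟨h12, h13, k1, k5, k7, k11⟩ := key
  have hper : ∀ m, M (m + 12) = M 13 * M m ∧ M (m + 13) = M 13 * M (m + 1) := by
    intro m
    induction m with
    | zero => simp [h12, hM0, hM1]
    | succ m ih =>
      refine ⟨by rw [show m + 1 + 12 = m + 13 by ring]; exact ih.2, ?_⟩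
      rw [show m + 1 + 13 = (m + 12) + 2 by ring, hM (m + 12),
        show m + 12 + 1 = m + 13 by ring, ih.1, ih.2, show m + 1 + 1 = m + 2 by ring, hM m]
      ring
  have hmul : ∀ k r, M r ≠ 0 → M (r + 12 * k) ≠ 0 := by
    intro k r hr
    haveI : Fact (Nat.Prime 11) := ⟨by norm_num⟩
    induction k with
    | zero => simpa using hr
    | succ k ih =>
      rw [show r + 12 * (k + 1) = (r + 12 * k) + 12 by ring, (hper _).1]
      exact mul_ne_zero h13 ih
  intro n hn h5
  rw [hz, ← hMd]
  have h2 : ¬ 2 ∣ n := fun h => by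
    have := (Nat.prime_dvd_prime_iff_eq Nat.prime_two hn).1 h
    omega
  have h3 : ¬ 3 ∣ n := fun h => by
    have := (Nat.prime_dvd_prime_iff_eq Nat.prime_three hn).1 h
    omega
  have hmod : n % 12 = 1 ∨ n % 12 = 5 ∨ n % 12 = 7 ∨ n % 12 = 11 := by omega
  have hr : M (n % 12) ≠ 0 := by
    rcases hmod with h | h | h | h <;> rw [h] <;> assumption
  have := hmul (n / 12) _ hr
  rwa [Nat.mod_add_div] at this
end
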